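/- arXiv:0707.4261 — 3 statements merged into one kernel-verified Lean document; each statement's English description precedes it below -/
import Mathlib

section
/- The set of pairs (u², t) of rational numbers with 0 < u² < t − 1 for which the finite cusp set C(Δ(u²,2t)) is a proper subset of ℚ (so that Δ(u²,2t) is neither pseudomodular nor arithmetic) is infinite. -/
open Matrix

/-- The projective general linear group `PGL₂(ℚ)`. -/
abbrev PGL2Q : Type := GL (Fin 2) ℚ ⧸ Subgroup.center (GL (Fin 2) ℚ)

/-- The canonical projection `GL₂(ℚ) → PGL₂(ℚ)`. -/
def pgl : GL (Fin 2) ℚ →* PGL2Q := QuotientGroup.mk' (Subgroup.center (GL (Fin 2) ℚ))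

/-- The Möbius action of a matrix `A ∈ GL₂(ℚ)` on `ℙ¹(ℚ) = ℚ ∪ {∞}`. -/
def moebius (A : GL (Fin 2) ℚ) (z : OnePoint ℚ) : OnePoint ℚ :=
  Option.elim z
    (if A.val 1 0 = 0 then OnePoint.infty else ((A.val 0 0 / A.val 1 0 : ℚ) : OnePoint ℚ))
    (fun x => if A.val 1 0 * x + A.val 1 1 = 0 then OnePoint.infty
      else (((A.val 0 0 * x + A.val 0 1) / (A.val 1 0 * x + A.val 1 1) : ℚ) : OnePoint ℚ))

/-- `Δ(u²,2t)`: the subgroup of `PGL₂(ℚ)` generated by the images of the matrices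
`M₁ = [[t−1, u²],[1, 1]]` and `M₂ = [[u², u²],[1, t−u²]]`. -/
def Delta (u2 t : ℚ) : Subgroup PGL2Q :=
  Subgroup.closure (pgl ''
    {A : GL (Fin 2) ℚ | A.val = !![t - 1, u2; 1, 1] ∨ A.val = !![u2, u2; 1, t - u2]})

/-- The set `C(Γ)` of finite cusps of a subgroup `Γ ≤ PGL₂(ℚ)`: rationals fixed by a
parabolic element of `Γ` (an element `γ ≠ 1` with `tr(A)² = 4·det(A)` for a representative
`A ∈ GL₂(ℚ)`). -/
def finiteCusps (Γ : Subgroup PGL2Q) : Set ℚ :=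
  {x : ℚ | ∃ A : GL (Fin 2) ℚ, pgl A ∈ Γ ∧ pgl A ≠ 1 ∧
    (A.val.trace) ^ 2 = 4 * A.val.det ∧ moebius A (x : OnePoint ℚ) = (x : OnePoint ℚ)}

section CuspFree

open Filter Topology

variable {u2 t : ℚ}

lemma smul_coe_eq_coe {g : GL (Fin 2) ℚ} {z w : ℚ} (hd : g.val 1 0 * z + g.val 1 1 ≠ 0)
    (hw : g.val 0 0 * z + g.val 0 1 = w * (g.val 1 0 * z + g.val 1 1)) :
    g • (z : OnePoint ℚ) = (w : OnePoint ℚ) := by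
  rw [OnePoint.smul_some_eq_ite, if_neg hd, ← (div_eq_iff hd).2 hw]

lemma moebius_coe (g : GL (Fin 2) ℚ) (z : ℚ) :
    moebius g (z : OnePoint ℚ) = g • (z : OnePoint ℚ) :=
  OnePoint.smul_some_eq_ite.symm

lemma smul_coe_eq_of_mem_center {g : GL (Fin 2) ℚ} (hg : g ∈ Subgroup.center (GL (Fin 2) ℚ))
    (z : ℚ) : g • (z : OnePoint ℚ) = (z : OnePoint ℚ) := by
  obtain ⟨a, ha⟩ := Matrix.GeneralLinearGroup.mem_center_iff_val_mem_range_scalar.1 hg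
  have hdet := g.det_ne_zero
  rw [← ha] at hdet
  apply smul_coe_eq_coe <;> rw [← ha]
  · simpa [Matrix.det_fin_two] using hdet
  · simp [mul_comm]

/-- The two generators of `Δ(u²,2t)` as elements of `GL₂(ℚ)`. -/
def deltaGen (h0 : 0 < u2) (h1 : u2 < t - 1) : Bool → GL (Fin 2) ℚ
  | false => Matrix.GeneralLinearGroup.mkOfDetNeZero !![t - 1, u2; 1, 1] (by
      rw [Matrix.det_fin_two_of]; linarith)
  | true => Matrix.GeneralLinearGroup.mkOfDetNeZero !![u2, u2; 1, t - u2] (by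
      rw [Matrix.det_fin_two_of, show u2 * (t - u2) - u2 * 1 = u2 * (t - 1 - u2) by ring]
      exact (mul_pos h0 (by linarith)).ne')

/-- A letter `(i, true)` stands for the `i`-th generator and `(i, false)` for its inverse. -/
def deltaLetter (h0 : 0 < u2) (h1 : u2 < t - 1) (a : Bool × Bool) : GL (Fin 2) ℚ :=
  cond a.2 (deltaGen h0 h1 a.1) (deltaGen h0 h1 a.1)⁻¹

/-- The attracting intervals of the letters, cut out by the ideal vertices `∞, -1, 0, u²`. -/
def pingPongCell (u2 : ℚ) : Bool × Bool → Set ℚ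
  | (false, true) => Set.Ioi u2
  | (false, false) => Set.Ioo (-1) 0
  | (true, true) => Set.Ioo 0 u2
  | (true, false) => Set.Iio (-1)

lemma pingPongCell_disjoint (h0 : 0 < u2) {a b : Bool × Bool} {z : ℚ}
    (ha : z ∈ pingPongCell u2 a) (hb : z ∈ pingPongCell u2 b) : a = b := by
  rcases a with ⟨_ | _, _ | _⟩ <;> rcases b with ⟨_ | _, _ | _⟩ <;>
    simp only [pingPongCell, Set.mem_Ioi, Set.mem_Iio, Set.mem_Ioo] at ha hb <;>
    first | rfl | (exfalso; linarith [ha.1, ha.2]) | (exfalso; linarith [hb.1, hb.2]) |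
      (exfalso; linarith)

lemma pingPongCell_isOpen (a : Bool × Bool) : IsOpen (pingPongCell u2 a) := by
  rcases a with ⟨_ | _, _ | _⟩
  exacts [isOpen_Ioo, isOpen_Ioi, isOpen_Iio, isOpen_Ioo]

lemma deltaGen_false_smul (h0 : 0 < u2) (h1 : u2 < t - 1) {z : ℚ} (hz : z < -1 ∨ 0 < z) :
    ∃ w ∈ pingPongCell u2 (false, true),
      deltaGen h0 h1 false • (z : OnePoint ℚ) = (w : OnePoint ℚ) := by
  have hd : z + 1 ≠ 0 := by rcases hz with h | h <;> intro <;> linarith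
  refine ⟨((t - 1) * z + u2) / (z + 1), ?_, smul_coe_eq_coe ?_ ?_⟩
  · have h : ((t - 1) * z + u2) / (z + 1) - u2 = (t - 1 - u2) * (z / (z + 1)) := by
      field_simp; ring
    have hq : 0 < z / (z + 1) := by
      rcases hz with h | h
      · exact div_pos_of_neg_of_neg (by linarith) (by linarith)
      · positivity
    have := mul_pos (sub_pos.2 h1) hq
    simp only [pingPongCell, Set.mem_Ioi]
    linarith
  · simpa [deltaGen] using hd
  · simp [deltaGen]; field_simp

lemma deltaGen_false_inv_smul (h0 : 0 < u2) (h1 : u2 < t - 1) {z : ℚ} (hz : z < u2) :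
    ∃ w ∈ pingPongCell u2 (false, false),
      (deltaGen h0 h1 false)⁻¹ • (z : OnePoint ℚ) = (w : OnePoint ℚ) := by
  have hd : 0 < t - 1 - z := by linarith
  have hw : (z - u2) / (t - 1 - z) + 1 = (t - 1 - u2) / (t - 1 - z) := by
    field_simp; ring
  have hw0 : 0 < (t - 1 - u2) / (t - 1 - z) := div_pos (by linarith) hd
  refine ⟨(z - u2) / (t - 1 - z), ⟨by linarith, div_neg_of_neg_of_pos (by linarith) hd⟩,
    inv_smul_eq_iff.2 (smul_coe_eq_coe ?_ ?_).symm⟩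
  · simp only [deltaGen, Matrix.GeneralLinearGroup.mkOfDetNeZero]
    simpa [hw] using hw0.ne'
  · simp [deltaGen]; field_simp; ring

lemma deltaGen_true_smul (h0 : 0 < u2) (h1 : u2 < t - 1) {z : ℚ} (hz : -1 < z) :
    ∃ w ∈ pingPongCell u2 (true, true),
      deltaGen h0 h1 true • (z : OnePoint ℚ) = (w : OnePoint ℚ) := by
  have hd : 0 < z + (t - u2) := by linarith
  refine ⟨u2 * (z + 1) / (z + (t - u2)), ⟨?_, ?_⟩, smul_coe_eq_coe ?_ ?_⟩
  · exact div_pos (mul_pos h0 (by linarith)) hd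
  · rw [div_lt_iff₀ hd]
    exact mul_lt_mul_of_pos_left (by linarith) h0
  · simpa [deltaGen] using hd.ne'
  · simp [deltaGen]; field_simp

lemma deltaGen_true_inv_smul (h0 : 0 < u2) (h1 : u2 < t - 1) {z : ℚ} (hz : z < 0 ∨ u2 < z) :
    ∃ w ∈ pingPongCell u2 (true, false),
      (deltaGen h0 h1 true)⁻¹ • (z : OnePoint ℚ) = (w : OnePoint ℚ) := by
  have hd : u2 - z ≠ 0 := by rcases hz with h | h <;> intro <;> linarith
  have hw : ((t - u2) * z - u2) / (u2 - z) + (t - u2) = u2 * (t - 1 - u2) / (u2 - z) := by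
    field_simp; ring
  refine ⟨((t - u2) * z - u2) / (u2 - z), ?_, inv_smul_eq_iff.2 (smul_coe_eq_coe ?_ ?_).symm⟩
  · have h : ((t - u2) * z - u2) / (u2 - z) + 1 = (t - 1 - u2) * (z / (u2 - z)) := by
      field_simp; ring
    have hq : z / (u2 - z) < 0 := by
      rcases hz with h | h
      · exact div_neg_of_neg_of_pos h (by linarith)
      · exact div_neg_of_pos_of_neg (by linarith) (by linarith)
    have := mul_neg_of_pos_of_neg (sub_pos.2 h1) hq
    simp only [pingPongCell, Set.mem_Iio]
    linarith
  · have : u2 * (t - 1 - u2) / (u2 - z) ≠ 0 :=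
      div_ne_zero (mul_pos h0 (by linarith)).ne' hd
    simpa [deltaGen, hw] using this
  · simp [deltaGen]; field_simp; ring

lemma deltaLetter_smul (h0 : 0 < u2) (h1 : u2 < t - 1) {a c : Bool × Bool}
    (hac : a.1 = c.1 → a.2 = c.2) {z : ℚ} (hz : z ∈ pingPongCell u2 c) :
    ∃ w ∈ pingPongCell u2 a, deltaLetter h0 h1 a • (z : OnePoint ℚ) = (w : OnePoint ℚ) := by
  rcases a with ⟨_ | _, _ | _⟩
  · refine deltaGen_false_inv_smul h0 h1 ?_
    rcases c with ⟨_ | _, _ | _⟩ <;> simp [pingPongCell] at hac hz <;> linarith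
  · refine deltaGen_false_smul h0 h1 ?_
    rcases c with ⟨_ | _, _ | _⟩ <;> simp [pingPongCell] at hac hz <;>
      first | (left; linarith) | (right; linarith)
  · refine deltaGen_true_inv_smul h0 h1 ?_
    rcases c with ⟨_ | _, _ | _⟩ <;> simp [pingPongCell] at hac hz <;>
      first | (left; linarith) | (right; linarith)
  · refine deltaGen_true_smul h0 h1 ?_
    rcases c with ⟨_ | _, _ | _⟩ <;> simp [pingPongCell] at hac hz <;> linarith

lemma deltaWord_smul (h0 : 0 < u2) (h1 : u2 < t - 1) {c : Bool × Bool} {z : ℚ}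
    (hz : z ∈ pingPongCell u2 c) (L : List (Bool × Bool)) (a : Bool × Bool)
    (hL : FreeGroup.IsReduced (a :: L ++ [c])) :
    ∃ w ∈ pingPongCell u2 a,
      ((a :: L).map (deltaLetter h0 h1)).prod • (z : OnePoint ℚ) = (w : OnePoint ℚ) := by
  induction L generalizing a with
  | nil =>
    have hac : a.1 = c.1 → a.2 = c.2 := by simpa [FreeGroup.IsReduced] using hL
    simpa using deltaLetter_smul h0 h1 hac hz
  | cons b L ih =>
    obtain ⟨hab, hb⟩ := FreeGroup.isReduced_cons_cons.1 hL
    obtain ⟨w, hw, hzw⟩ := ih b hb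
    obtain ⟨w', hw', hww'⟩ := deltaLetter_smul h0 h1 hab hw
    exact ⟨w', hw', by rw [List.map_cons, List.prod_cons, mul_smul, hzw, hww']⟩

lemma Delta_eq_map_range (h0 : 0 < u2) (h1 : u2 < t - 1) :
    Delta u2 t = (FreeGroup.lift (deltaGen h0 h1)).range.map pgl := by
  rw [FreeGroup.range_lift_eq_closure, MonoidHom.map_closure, Delta]
  congr 2
  ext A
  constructor
  · rintro (h | h)
    · exact ⟨false, Units.ext h.symm⟩
    · exact ⟨true, Units.ext h.symm⟩
  · rintro ⟨_ | _, rfl⟩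
    · exact Or.inl rfl
    · exact Or.inr rfl

/-- An element of `Δ(u²,2t)` that keeps one point of each ping-pong interval inside that interval is
trivial. -/
lemma pgl_eq_one_of_preserves_cells (h0 : 0 < u2) (h1 : u2 < t - 1) {B : GL (Fin 2) ℚ}
    (hB : pgl B ∈ Delta u2 t)
    (h : ∀ c : Bool × Bool, ∃ z ∈ pingPongCell u2 c,
      ∃ w ∈ pingPongCell u2 c, B • (z : OnePoint ℚ) = (w : OnePoint ℚ)) :
    pgl B = 1 := by
  rw [Delta_eq_map_range h0 h1] at hB
  obtain ⟨_, ⟨x, rfl⟩, hx⟩ := hB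
  rcases hL : x.toWord with _ | ⟨a, L⟩
  · rw [FreeGroup.toWord_eq_nil_iff] at hL
    rw [← hx, hL, map_one, map_one]
  exfalso
  have hred : FreeGroup.IsReduced (a :: L) := hL ▸ FreeGroup.isReduced_toWord
  have hprod : FreeGroup.lift (deltaGen h0 h1) x = ((a :: L).map (deltaLetter h0 h1)).prod := by
    rw [← hL]
    conv_lhs => rw [← FreeGroup.mk_toWord (x := x), FreeGroup.lift_mk]
    rfl
  have hcenter : (FreeGroup.lift (deltaGen h0 h1) x)⁻¹ * B ∈ Subgroup.center (GL (Fin 2) ℚ) :=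
    QuotientGroup.eq.1 hx
  have hact (z : ℚ) : B • (z : OnePoint ℚ)
      = ((a :: L).map (deltaLetter h0 h1)).prod • (z : OnePoint ℚ) := by
    rw [← hprod, ← inv_smul_eq_iff, ← mul_smul]
    exact smul_coe_eq_of_mem_center hcenter z
  obtain ⟨b, hb⟩ : ∃ b, (a :: L).getLast? = some b := by simp [List.getLast?_cons]
  have key (c : Bool × Bool) (hbc : b.1 = c.1 → b.2 = c.2) :
      c = a := by
    obtain ⟨z, hz, w, hw, hzw⟩ := h c
    have hchain : FreeGroup.IsReduced (a :: L ++ [c]) :=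
      List.isChain_append.2 ⟨hred, by simp, by simpa [hb] using hbc⟩
    obtain ⟨w', hw', hzw'⟩ := deltaWord_smul h0 h1 hz L a hchain
    rw [hact, hzw', OnePoint.coe_eq_coe] at hzw
    exact pingPongCell_disjoint h0 hw (hzw ▸ hw')
  exact (by decide : ∀ a b : Bool × Bool, ¬ ∀ c : Bool × Bool, (b.1 = c.1 → b.2 = c.2) → c = a)
    a b key

/-- The rational fixed point `n` of the hyperbolic generator `M₁` of `Δ(mn, 2(n - m + 2))` is not
a cusp. -/
lemma notMem_finiteCusps {m n : ℚ} (hm0 : 0 < m) (hm1 : m < 1) (hn : 0 < n) :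
    n ∉ finiteCusps (Delta (m * n) (n - m + 2)) := by
  rintro ⟨A, hA, hA1, htr, hfix⟩
  have h0 : 0 < m * n := mul_pos hm0 hn
  have h1 : m * n < n - m + 2 - 1 := by nlinarith [mul_pos (sub_pos.2 hm1) (add_pos hn one_pos)]
  rw [moebius_coe, OnePoint.smul_some_eq_ite] at hfix
  set N : Matrix (Fin 2) (Fin 2) ℚ := !![n, -n ^ 2; 1, -n] with hN
  obtain ⟨l, c, hl, hAval⟩ : ∃ l c : ℚ, l ≠ 0 ∧ A.val = l • 1 + c • N := by
    have hd : A.val 1 0 * n + A.val 1 1 ≠ 0 := by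
      intro hd
      simp [hd] at hfix
    have hb : A.val 0 0 * n + A.val 0 1 = n * (A.val 1 0 * n + A.val 1 1) := by
      rw [← div_eq_iff hd]
      rwa [if_neg hd, OnePoint.coe_eq_coe] at hfix
    rw [Matrix.trace_fin_two, Matrix.det_fin_two] at htr
    have hsq : (A.val 0 0 - A.val 1 1 - 2 * A.val 1 0 * n) ^ 2 = 0 := by
      linear_combination htr - 4 * A.val 1 0 * hb
    have ha := pow_eq_zero_iff (two_ne_zero) |>.1 hsq
    refine ⟨_, A.val 1 0, hd, ?_⟩
    ext i j
    fin_cases i <;> fin_cases j <;> simp [hN]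
    · linear_combination ha
    · linear_combination hb - n * ha
  set r : ℚ := (1 - m) / (n + 1)
  have hconj (k : ℕ) : ∃ B : GL (Fin 2) ℚ, pgl B ∈ Delta (m * n) (n - m + 2) ∧ pgl B ≠ 1 ∧
      B.val = l • 1 + (c * r ^ k) • N := by
    induction k with
    | zero => exact ⟨A, hA, hA1, by simpa using hAval⟩
    | succ k ih =>
      obtain ⟨B, hB, hB1, hBval⟩ := ih
      set g := deltaGen h0 h1 false with hg
      have hgmem : pgl g ∈ Delta (m * n) (n - m + 2) :=
        Subgroup.subset_closure ⟨g, Or.inl rfl, rfl⟩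
      refine ⟨g⁻¹ * (B * g), ?_, ?_, ?_⟩
      · rw [map_mul, map_mul, map_inv]
        exact mul_mem (inv_mem hgmem) (mul_mem hB hgmem)
      · rw [map_mul, map_mul, map_inv]
        intro h
        apply hB1
        rw [inv_mul_eq_one] at h
        exact mul_eq_right.1 h.symm
      · have hcomm : (B * g).val = g.val * (l • 1 + (c * r ^ (k + 1)) • N) := by
          rw [Units.val_mul, hBval, hN, hg]
          have hr' : r * (n + 1) = 1 - m := div_mul_cancel₀ _ (by linarith)
          ext i j
          fin_cases i <;> fin_cases j <;>
            simp [deltaGen, Matrix.mul_apply, Fin.sum_univ_two, pow_succ]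
          · linear_combination -(c * r ^ k * n) * hr'
          · linear_combination c * r ^ k * n ^ 2 * hr'
          · linear_combination -(c * r ^ k) * hr'
          · linear_combination c * r ^ k * n * hr'
        rw [Units.val_mul, hcomm, ← mul_assoc, ← Units.val_mul, inv_mul_cancel, Units.val_one,
          one_mul]
  have htend : Tendsto (fun k : ℕ => c / l * r ^ k) atTop (𝓝 0) := by
    have := (tendsto_pow_atTop_nhds_zero_of_lt_one (r := r) (div_nonneg (by linarith) (by linarith))
      ((div_lt_one (by linarith)).2 (by linarith))).const_mul (c / l)
    simpa using this
  have hnear (a : Bool × Bool) (z : ℚ) (hz : z ∈ pingPongCell (m * n) a) :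
      ∀ᶠ e : ℚ in 𝓝 0, 1 + e * (z - n) ≠ 0 ∧
        (z + e * n * (z - n)) / (1 + e * (z - n)) ∈ pingPongCell (m * n) a := by
    have hc : ContinuousAt (fun e : ℚ => 1 + e * (z - n)) 0 := by fun_prop
    have hq : ContinuousAt (fun e : ℚ => (z + e * n * (z - n)) / (1 + e * (z - n))) 0 :=
      ContinuousAt.div (by fun_prop) hc (by simp)
    exact (hc.eventually_ne (by simp)).and
      (hq.eventually_mem ((pingPongCell_isOpen a).mem_nhds (by simpa using hz)))
  obtain ⟨s, hs⟩ : ∃ s : Bool × Bool → ℚ, ∀ a, s a ∈ pingPongCell (m * n) a := by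
    refine ⟨fun a => match a with
      | (false, true) => m * n + 1
      | (false, false) => -1 / 2
      | (true, true) => m * n / 2
      | (true, false) => -2, ?_⟩
    rintro ⟨_ | _, _ | _⟩ <;> simp only [pingPongCell, Set.mem_Ioi, Set.mem_Iio, Set.mem_Ioo] <;>
      first | (constructor <;> linarith) | linarith
  obtain ⟨k, hk⟩ := (htend.eventually (eventually_all.2 fun a => hnear a (s a) (hs a))).exists
  obtain ⟨B, hB, hB1, hBval⟩ := hconj k
  refine hB1 (pgl_eq_one_of_preserves_cells h0 h1 hB fun a => ⟨s a, hs a, _, (hk a).2, ?_⟩)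
  have hden : B.val 1 0 * s a + B.val 1 1 = l * (1 + c / l * r ^ k * (s a - n)) := by
    simp [hBval, hN]; field_simp; ring
  refine smul_coe_eq_coe (hden ▸ mul_ne_zero hl (hk a).1) ?_
  rw [hden, mul_left_comm, div_mul_cancel₀ _ (hk a).1]
  simp [hBval, hN]; field_simp; ring

end CuspFree

/-- Infinitely many pairs `(u², t)` with `0 < u² < t − 1` have
`C(Δ(u²,2t)) ⊊ ℚ`, i.e. yield groups `Δ(u²,2t)` that are neither pseudomodular nor
arithmetic. -/
theorem infinitely_many_non_pseudomodular :
    {q : ℚ × ℚ | 0 < q.1 ∧ q.1 < q.2 - 1 ∧ finiteCusps (Delta q.1 q.2) ≠ Set.univ}.Infinite := by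
  refine Set.infinite_of_injective_forall_mem
    (f := fun k : ℕ => ((1 / 2 * (k + 1), (k + 1) - 1 / 2 + 2) : ℚ × ℚ)) ?_ ?_
  · intro j k h
    simpa using congrArg Prod.fst h
  · intro k
    have hk : (0 : ℚ) < k + 1 := by positivity
    refine ⟨by positivity, ?_, fun h => ?_⟩
    · dsimp only
      linarith
    · exact notMem_finiteCusps (m := 1 / 2) (by norm_num) (by norm_num) hk (h ▸ Set.mem_univ _)
end

section
/- Let t be a prime number and u² a rational number with 0 < u² < t − 1 such that the denominator of u² is a prime different from t and u² is congruent to 0 or −1 modulo t (i.e. v_t(u²) > 0 or v_t(u² + 1) > 0). Then the image of the finite cusp set C(Δ(u²,2t)) under the diagonal embedding of ℚ into the product ∏_p ℚ_p over all primes p, equipped with the product topology, is dense. -/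
open Matrix

instance (p : Nat.Primes) : Fact (p : ℕ).Prime := ⟨p.2⟩

section LocalOrbits

/-- The behaviour at a prime `p` of the Möbius maps `a : z ↦ t - β / z`,
`b : z ↦ t - 1 - (t - 1 - β) / (z + 1)` and `z ↦ z + 2 t` on classes `f z` of points of `ℚ_p`
and the class `o` of `∞`. -/
structure TorusAction {p : ℕ} [Fact p.Prime] {Q : Type*} (t β : ℚ_[p]) (a b : Q → Q)
    (f : ℚ_[p] → Q) (o : Q) : Prop where
  inj : Function.Injective a
  translate : ∀ z w, ‖z - w‖ ≤ ‖2 * t‖ → f z = f w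
  a_infty : a o = f t
  a_zero : a (f 0) = o
  a_apply : ∀ z, z ≠ 0 → a (f z) = f (t - β / z)
  b_infty : b o = f (t - 1)
  b_neg_one : b (f (-1)) = o

/-- Every class is of the form `a^[i] o`; moreover `a^[n]` fixes `o` and `b` acts on `o` as
`a^[m]`. -/
structure CyclicClasses {K Q : Type*} (a b : Q → Q) (f : K → Q) (o : Q) (n m : ℕ) : Prop where
  cover : ∀ z, ∃ i, f z = a^[i] o
  period : a^[n] o = o
  b_infty : b o = a^[m] o

lemma norm_sub_le_half {x y : ℚ_[2]} (h : ‖x‖ = ‖y‖) : ‖x - y‖ ≤ ‖x‖ / 2 := by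
  rcases eq_or_ne y 0 with rfl | hy
  · simp_all
  have hx : x ≠ 0 := by
    rintro rfl
    exact hy (norm_eq_zero.1 (by simpa using h.symm))
  have hu : ‖x / y‖ = 1 := by rw [norm_div, h, div_self (norm_ne_zero_iff.2 hy)]
  obtain ⟨u, hxu⟩ : ∃ u : ℤ_[2], (u : ℚ_[2]) = x / y := ⟨⟨x / y, hu.le⟩, rfl⟩
  have hr : u.zmodRepr = 1 := by
    have h0 := (PadicInt.norm_natCast_zmodRepr_eq_one_iff_ne u).1
      (PadicInt.norm_natCast_zmodRepr_eq_one_iff.2 (by rw [PadicInt.norm_def, hxu, hu]))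
    have := u.zmodRepr_lt_p
    omega
  have h1 : ‖x / y - 1‖ < 1 := by
    have := u.norm_sub_zmodRepr_lt_one
    rw [hr] at this
    simpa [PadicInt.norm_def, hxu] using this
  have h2 : ‖x / y - 1‖ ≤ 1 / 2 := by
    have := Padic.norm_lt_pow_iff_norm_le_pow_sub_one (x / y - 1) 0
    norm_num at this
    exact this.1 h1
  have h3 : x - y = (x / y - 1) * y := by field_simp
  rw [h3, norm_mul, h]
  have := mul_le_mul_of_nonneg_right h2 (norm_nonneg y)
  linarith

lemma norm_cases_two (x : ℚ_[2]) :
    ‖x‖ ≤ 1 / 4 ∨ ‖x‖ = 1 / 2 ∨ ‖x‖ = 1 ∨ ‖x‖ = 2 ∨ 4 ≤ ‖x‖ := by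
  rcases eq_or_ne x 0 with rfl | hx
  · simp
  rw [Padic.norm_eq_zpow_neg_valuation hx]
  obtain h | h | h | h | h : -x.valuation ≤ -2 ∨ -x.valuation = -1 ∨ -x.valuation = 0 ∨
    -x.valuation = 1 ∨ 2 ≤ -x.valuation := by omega
  · left
    calc ((2 : ℕ) : ℝ) ^ (-x.valuation) ≤ 2 ^ (-2 : ℤ) := by
          push_cast; exact zpow_le_zpow_right₀ (by norm_num) h
      _ = 1 / 4 := by norm_num
  · simp only [h]; norm_num
  · simp only [h]; norm_num
  · simp only [h]; norm_num
  · right; right; right; right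
    calc (4 : ℝ) = 2 ^ (2 : ℤ) := by norm_num
      _ ≤ ((2 : ℕ) : ℝ) ^ (-x.valuation) := by
          push_cast; exact zpow_le_zpow_right₀ (by norm_num) h

lemma norm_le_inv_or_one_le {p : ℕ} [Fact p.Prime] (x : ℚ_[p]) : ‖x‖ ≤ (p : ℝ)⁻¹ ∨ 1 ≤ ‖x‖ := by
  have := Padic.norm_lt_pow_iff_norm_le_pow_sub_one x 0
  simp at this
  rw [← this]
  exact lt_or_ge _ _

lemma norm_le_one_or_le {p : ℕ} [Fact p.Prime] (x : ℚ_[p]) : ‖x‖ ≤ 1 ∨ (p : ℝ) ≤ ‖x‖ := by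
  have := Padic.norm_le_pow_iff_norm_lt_pow_add_one x 0
  simp at this
  rw [this]
  exact lt_or_ge _ _

lemma norm_add_eq_left {p : ℕ} [Fact p.Prime] {x y : ℚ_[p]} (h : ‖y‖ < ‖x‖) : ‖x + y‖ = ‖x‖ := by
  rw [Padic.add_eq_max_of_ne h.ne', max_eq_left h.le]

lemma norm_sub_eq_left {p : ℕ} [Fact p.Prime] {x y : ℚ_[p]} (h : ‖y‖ < ‖x‖) : ‖x - y‖ = ‖x‖ := by
  rw [sub_eq_add_neg]
  exact norm_add_eq_left (by rwa [norm_neg])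

lemma norm_sub_eq_right {p : ℕ} [Fact p.Prime] {x y : ℚ_[p]} (h : ‖x‖ < ‖y‖) :
    ‖x - y‖ = ‖y‖ := by
  rw [norm_sub_rev, norm_sub_eq_left h]

lemma padicNorm_sub_le {p : ℕ} [Fact p.Prime] {x y : ℚ_[p]} {r : ℝ} (hx : ‖x‖ ≤ r)
    (hy : ‖y‖ ≤ r) : ‖x - y‖ ≤ r := by
  rw [sub_eq_add_neg]
  exact (Padic.nonarchimedean x (-y)).trans (max_le hx (by rwa [norm_neg]))

namespace TorusAction

variable {p : ℕ} [Fact p.Prime] {Q : Type*} {t β : ℚ_[p]} {a b : Q → Q} {f : ℚ_[p] → Q} {o : Q}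

lemma eq_infty (h : TorusAction t β a b f o) {z : ℚ_[p]} (hz : z ≠ 0)
    (hβ : ‖β‖ ≤ ‖2 * t‖ * ‖z‖) : f z = o := by
  apply h.inj
  rw [h.a_apply z hz, h.a_infty]
  apply h.translate
  rw [sub_sub_cancel_left, norm_neg, norm_div]
  exact div_le_of_le_mul₀ (norm_nonneg _) (norm_nonneg _) hβ

lemma eq_a_apply (h : TorusAction t β a b f o) (hβ : β ≠ 0) {z : ℚ_[p]} (hz : t - z ≠ 0) :
    f z = a (f (β / (t - z))) := by
  rw [h.a_apply _ (div_ne_zero hβ hz), div_div_cancel₀ hβ, sub_sub_cancel]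

lemma cyclicClasses_of_unit (h : TorusAction t β a b f o) (ht : ‖2 * t‖ = 1) (hβ : ‖β‖ ≤ 1) :
    CyclicClasses a b f o 1 0 := by
  have h1 : ∀ z, 1 ≤ ‖z‖ → f z = o := fun z hz ↦ by
    refine h.eq_infty (norm_pos_iff.1 (by linarith)) ?_
    rw [ht]; linarith
  have h2 : ∀ z, f z = o := fun z ↦ by
    rcases le_total 1 ‖z‖ with hz | hz
    · exact h1 z hz
    · rw [h.translate z 1 (by rw [ht]; exact padicNorm_sub_le hz (by simp)), h1 1 (by simp)]
  exact ⟨fun z ↦ ⟨0, h2 z⟩, by simp [h.a_infty, h2], by simp [h.b_infty, h2]⟩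

lemma cyclicClasses_of_denominator (h : TorusAction t β a b f o) (h2 : ‖(2 : ℚ_[p])‖ = 1)
    (ht : ‖t‖ = 1) (hβ : ‖β‖ = p) : CyclicClasses a b f o 2 1 := by
  have hp : (1 : ℝ) < p := by exact_mod_cast (Fact.out : p.Prime).one_lt
  have h2t : ‖2 * t‖ = 1 := by rw [norm_mul, h2, ht, one_mul]
  have ht0 : t ≠ 0 := norm_pos_iff.1 (by linarith)
  have h1 : ∀ z, ‖z‖ ≤ 1 → f z = a o := fun z hz ↦ by
    rw [h.a_infty]
    exact h.translate _ _ (by rw [h2t]; exact padicNorm_sub_le hz ht.le)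
  have h3 : ∀ z, (p : ℝ) ≤ ‖z‖ → f z = o := fun z hz ↦
    h.eq_infty (norm_pos_iff.1 (by linarith)) (by rw [h2t, hβ]; linarith)
  refine ⟨fun z ↦ ?_, ?_, ?_⟩
  · rcases norm_le_one_or_le z with hz | hz
    · exact ⟨1, h1 z hz⟩
    · exact ⟨0, h3 z hz⟩
  · have hq : ‖β / t‖ = p := by rw [norm_div, ht, hβ, div_one]
    change a (a o) = o
    rw [h.a_infty, h.a_apply t ht0, h3]
    rw [norm_sub_eq_right (by rw [hq, ht]; exact hp), hq]
  · simpa [h.b_infty] using h1 (t - 1) (padicNorm_sub_le ht.le (by simp))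

lemma cyclicClasses_of_dvd (h : TorusAction t β a b f o) (h2 : ‖(2 : ℚ_[p])‖ = 1)
    (ht : ‖t‖ = (p : ℝ)⁻¹) (hβ : ‖β‖ < 1) : CyclicClasses a b f o 2 0 := by
  have hp : (1 : ℝ) < p := by exact_mod_cast (Fact.out : p.Prime).one_lt
  have hp' : (p : ℝ)⁻¹ < 1 := inv_lt_one_of_one_lt₀ hp
  have hp0 : 0 < (p : ℝ)⁻¹ := by positivity
  have h2t : ‖2 * t‖ = (p : ℝ)⁻¹ := by rw [norm_mul, h2, ht, one_mul]
  have ht0 : t ≠ 0 := norm_pos_iff.1 (by linarith)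
  have hβ' : ‖β‖ ≤ (p : ℝ)⁻¹ := (norm_le_inv_or_one_le β).resolve_right (by linarith)
  have h1 : ∀ z, ‖z‖ ≤ (p : ℝ)⁻¹ → f z = a o := fun z hz ↦ by
    rw [h.a_infty]
    exact h.translate _ _ (by rw [h2t]; exact padicNorm_sub_le hz ht.le)
  have h3 : ∀ z, 1 ≤ ‖z‖ → f z = o := fun z hz ↦
    h.eq_infty (norm_pos_iff.1 (by linarith)) (by rw [h2t]; nlinarith)
  refine ⟨fun z ↦ ?_, ?_, ?_⟩
  · rcases norm_le_inv_or_one_le z with hz | hz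
    · exact ⟨1, h1 z hz⟩
    · exact ⟨0, h3 z hz⟩
  · change a (a o) = o
    rcases norm_le_inv_or_one_le (β / t) with hz | hz
    · have hs : f t = o := by
        refine h.eq_infty ht0 ?_
        rw [norm_div, div_le_iff₀ (norm_pos_iff.2 ht0)] at hz
        rwa [h2t]
      rw [h.a_infty, hs, h.a_infty, hs]
    · rw [h.a_infty, h.a_apply t ht0, h3]
      rw [norm_sub_eq_right (by rw [ht]; linarith)]
      exact hz
  · have : ‖t - 1‖ = 1 := by rw [norm_sub_eq_right (by rw [ht]; simpa using hp'), norm_one]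
    simpa [h.b_infty] using h3 (t - 1) this.ge

end TorusAction

namespace TorusAction

variable {Q : Type*} {t β : ℚ_[2]} {a b : Q → Q} {f : ℚ_[2] → Q} {o : Q}

lemma cyclicClasses_two_of_odd (h : TorusAction t β a b f o) (ht : ‖t‖ = 1)
    (hβ : ‖β‖ ≤ 1) : CyclicClasses a b f o 3 2 := by
  have h2 : ‖(2 : ℚ_[2])‖ = 1 / 2 := by simpa using Padic.norm_p (p := 2)
  have h2t : ‖2 * t‖ = 1 / 2 := by rw [norm_mul, h2, ht, mul_one]
  have ht0 : t ≠ 0 := norm_pos_iff.1 (by linarith)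
  have ht1 : ‖t - 1‖ ≤ 1 / 2 := by simpa [ht] using norm_sub_le_half (x := t) (y := 1) (by simp [ht])
  have h0 : ∀ z, ‖z‖ ≤ 1 / 2 → f z = f 0 := fun z hz ↦ h.translate _ _ (by simpa [h2t] using hz)
  rcases norm_le_inv_or_one_le β with hβ' | hβ'
  · have h1 : ∀ z, 1 ≤ ‖z‖ → f z = o := fun z hz ↦
      h.eq_infty (norm_pos_iff.1 (by linarith)) (by rw [h2t]; norm_num at hβ'; linarith)
    have h00 : f 0 = o := by
      rw [← h0 _ ht1, ← h.b_infty, ← h1 (-1) (by simp), h.b_neg_one, h1 (-1) (by simp)]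
    have h3 : ∀ z, f z = o := fun z ↦ by
      rcases norm_le_inv_or_one_le z with hz | hz
      · rw [h0 z (by simpa using hz), h00]
      · exact h1 z hz
    have h4 : a o = o := by rw [h.a_infty, h3]
    exact ⟨fun z ↦ ⟨0, h3 z⟩, by simp [h4], by simp [h4, h.b_infty, h3]⟩
  · have hβ1 : ‖β‖ = 1 := le_antisymm hβ hβ'
    have h1 : ∀ z, ‖z‖ = 1 → f z = a o := fun z hz ↦ by
      rw [h.a_infty]
      exact h.translate _ _ (by rw [h2t, ← hz]; exact norm_sub_le_half (by rw [hz, ht]))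
    have haa : a (a o) = f 0 := by
      rw [h.a_infty, h.a_apply t ht0]
      refine h0 _ ?_
      simpa [ht] using norm_sub_le_half (x := t) (y := β / t) (by simp [ht, hβ1])
    refine ⟨fun z ↦ ?_, by simp [haa, h.a_zero], by simp [haa, h.b_infty, h0 _ ht1]⟩
    have hi : 2 ≤ ‖z‖ → f z = o := fun hz ↦
      h.eq_infty (norm_pos_iff.1 (by linarith)) (by rw [h2t]; linarith)
    rcases norm_cases_two z with hz | hz | hz | hz | hz
    · exact ⟨2, by simp [haa, h0 z (by linarith)]⟩
    · exact ⟨2, by simp [haa, h0 z (by linarith)]⟩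
    · exact ⟨1, h1 z hz⟩
    · exact ⟨0, hi hz.ge⟩
    · exact ⟨0, hi (by linarith)⟩

lemma cyclicClasses_two_of_denominator (h : TorusAction t β a b f o) (ht : ‖t‖ = 1)
    (hβ : ‖β‖ = 2) : CyclicClasses a b f o 4 3 := by
  have h2 : ‖(2 : ℚ_[2])‖ = 1 / 2 := by simpa using Padic.norm_p (p := 2)
  have h2t : ‖2 * t‖ = 1 / 2 := by rw [norm_mul, h2, ht, mul_one]
  have hβ0 : β ≠ 0 := norm_pos_iff.1 (by linarith)
  have ht1 : ‖t - 1‖ ≤ 1 / 2 := by simpa [ht] using norm_sub_le_half (x := t) (y := 1) (by simp [ht])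
  have h1 : ∀ z, ‖z‖ = 1 → f z = a o := fun z hz ↦ by
    rw [h.a_infty]
    exact h.translate _ _ (by rw [h2t, ← hz]; exact norm_sub_le_half (by rw [hz, ht]))
  have hh : ∀ z, ‖z‖ = 2 → f z = a (a o) := fun z hz ↦ by
    have hs : ‖t - z‖ = 2 := by rw [norm_sub_eq_right (by rw [ht, hz]; norm_num), hz]
    rw [h.eq_a_apply hβ0 (norm_pos_iff.1 (by rw [hs]; norm_num)), h1]
    rw [norm_div, hβ, hs]; norm_num
  have he : ∀ z, ‖z‖ ≤ 1 / 2 → f z = a (a (a o)) := fun z hz ↦ by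
    have hs : ‖t - z‖ = 1 := by rw [norm_sub_eq_left (by rw [ht]; linarith), ht]
    rw [h.eq_a_apply hβ0 (norm_pos_iff.1 (by rw [hs]; norm_num)), hh]
    rw [norm_div, hβ, hs]; norm_num
  refine ⟨fun z ↦ ?_, ?_, ?_⟩
  · rcases norm_cases_two z with hz | hz | hz | hz | hz
    · exact ⟨3, he z (by linarith)⟩
    · exact ⟨3, he z (by linarith)⟩
    · exact ⟨1, h1 z hz⟩
    · exact ⟨2, hh z hz⟩
    · exact ⟨0, h.eq_infty (norm_pos_iff.1 (by linarith)) (by rw [h2t]; linarith)⟩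
  · simp [← he 0 (by simp), h.a_zero]
  · simp [h.b_infty, he _ ht1]

lemma cyclicClasses_two_of_two (h : TorusAction 2 β a b f o) (hβ0 : β ≠ 0) (hβ : ‖β‖ < 1) :
    CyclicClasses a b f o 4 2 ∨ CyclicClasses a b f o 3 0 := by
  have h2 : ‖(2 : ℚ_[2])‖ = 1 / 2 := by simpa using Padic.norm_p (p := 2)
  have h2t : ‖(2 : ℚ_[2]) * 2‖ = 1 / 4 := by rw [norm_mul, h2]; norm_num
  have hd : ∀ z, ‖z‖ = 1 / 2 → f z = a o := fun z hz ↦ by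
    rw [h.a_infty]
    refine h.translate _ _ ?_
    rw [h2t]
    exact (norm_sub_le_half (by rw [hz, h2])).trans (by rw [hz]; norm_num)
  have hq : ∀ z, ‖z‖ ≤ 1 / 4 → f z = f 0 := fun z hz ↦ h.translate _ _ (by simpa [h2t] using hz)
  have hb : b o = f 1 := by rw [h.b_infty]; norm_num
  rcases norm_cases_two β with hβ' | hβ' | hβ' | hβ' | hβ'
  · right
    have h1 : ∀ z, 1 ≤ ‖z‖ → f z = o := fun z hz ↦
      h.eq_infty (norm_pos_iff.1 (by linarith)) (by rw [h2t]; linarith)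
    rcases norm_cases_two (β / 2) with hs | hs | hs | hs | hs
    · have hao : a o = o := by
        rw [h.a_infty]
        refine h.eq_infty two_ne_zero ?_
        rw [norm_div, div_le_iff₀ (by rw [h2]; norm_num)] at hs
        rwa [h2t]
      have h00 : f 0 = o := h.inj (by rw [h.a_zero, hao])
      refine ⟨fun z ↦ ⟨0, ?_⟩, by simp [hao], by simp [hb, h1]⟩
      rcases norm_cases_two z with hz | hz | hz | hz | hz
      · simp [hq z hz, h00]
      · simp [hd z hz, hao]
      all_goals exact h1 z (by linarith)
    · have haa : a (a o) = f 0 := by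
        rw [h.a_infty, h.a_apply 2 two_ne_zero]
        refine hq _ ((norm_sub_le_half (by rw [h2, hs])).trans (by rw [h2]; norm_num))
      refine ⟨fun z ↦ ?_, by simp [haa, h.a_zero], by simp [hb, h1]⟩
      rcases norm_cases_two z with hz | hz | hz | hz | hz
      · exact ⟨2, by simp [hq z hz, haa]⟩
      · exact ⟨1, hd z hz⟩
      all_goals exact ⟨0, h1 z (by linarith)⟩
    all_goals
      exfalso
      rw [norm_div, h2] at hs
      linarith
  · left
    have h1 : ∀ z, ‖z‖ = 1 → f z = a (a o) := fun z hz ↦ by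
      have hs : ‖2 - z‖ = 1 := by rw [norm_sub_eq_right (by rw [h2, hz]; norm_num), hz]
      rw [h.eq_a_apply hβ0 (norm_pos_iff.1 (by rw [hs]; norm_num)), hd]
      rw [norm_div, hβ', hs]; norm_num
    have he : ∀ z, ‖z‖ ≤ 1 / 4 → f z = a (a (a o)) := fun z hz ↦ by
      have hs : ‖2 - z‖ = 1 / 2 := by rw [norm_sub_eq_left (by rw [h2]; linarith), h2]
      rw [h.eq_a_apply hβ0 (norm_pos_iff.1 (by rw [hs]; norm_num)), h1]
      rw [norm_div, hβ', hs]; norm_num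
    refine ⟨fun z ↦ ?_, by simp [← he 0 (by simp), h.a_zero], by simp [hb, h1]⟩
    have hi : 2 ≤ ‖z‖ → f z = o := fun hz ↦
      h.eq_infty (norm_pos_iff.1 (by linarith)) (by rw [h2t]; linarith)
    rcases norm_cases_two z with hz | hz | hz | hz | hz
    · exact ⟨3, he z hz⟩
    · exact ⟨1, hd z hz⟩
    · exact ⟨2, h1 z hz⟩
    · exact ⟨0, hi hz.ge⟩
    · exact ⟨0, hi (by linarith)⟩
  all_goals linarith

end TorusAction

end LocalOrbits

section AdelicClosure

open Function

/-- Vectors in `∏ₚ ℚ_p²`. -/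
abbrev AdelicVector : Type := ∀ p : Nat.Primes, Fin 2 → ℚ_[(p : ℕ)]

/-- The action of `GL₂(ℚ)` on `ℚ_p²`. -/
noncomputable def localAct (p : Nat.Primes) (g : GL (Fin 2) ℚ) (a : Fin 2 → ℚ_[(p : ℕ)]) :
    Fin 2 → ℚ_[(p : ℕ)] :=
  g.val.map (algebraMap ℚ ℚ_[(p : ℕ)]) *ᵥ a

/-- The diagonal action of `GL₂(ℚ)` on `∏ₚ ℚ_p²`. -/
noncomputable def adelicAct (g : GL (Fin 2) ℚ) (v : AdelicVector) : AdelicVector :=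
  fun p ↦ localAct p g (v p)

/-- The closure in `∏ₚ ℚ_p²` of the cone over the orbit of `∞` under `G`. -/
def orbitClosure (G : Subgroup (GL (Fin 2) ℚ)) : Set AdelicVector :=
  closure {v | ∃ g ∈ G, ∀ p : Nat.Primes, ∃ c : ℚ_[(p : ℕ)], c ≠ 0 ∧ v p = c • localAct p g ![1, 0]}

lemma localAct_apply (p : Nat.Primes) (g : GL (Fin 2) ℚ) (a : Fin 2 → ℚ_[(p : ℕ)]) :
    localAct p g a = ![(g.val 0 0 : ℚ_[(p : ℕ)]) * a 0 + g.val 0 1 * a 1,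
      (g.val 1 0 : ℚ_[(p : ℕ)]) * a 0 + g.val 1 1 * a 1] := by
  ext i
  fin_cases i <;> simp [localAct, mulVec, dotProduct, Fin.sum_univ_two]

lemma localAct_mul (p : Nat.Primes) (g h : GL (Fin 2) ℚ) (a : Fin 2 → ℚ_[(p : ℕ)]) :
    localAct p (g * h) a = localAct p g (localAct p h a) := by
  simp only [localAct, mulVec_mulVec, ← Matrix.map_mul, Units.val_mul]

lemma localAct_one (p : Nat.Primes) (a : Fin 2 → ℚ_[(p : ℕ)]) : localAct p 1 a = a := by
  simp [localAct]

lemma localAct_smul (p : Nat.Primes) (g : GL (Fin 2) ℚ) (c : ℚ_[(p : ℕ)])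
    (a : Fin 2 → ℚ_[(p : ℕ)]) : localAct p g (c • a) = c • localAct p g a := by
  simp [localAct, mulVec_smul]

lemma adelicAct_inv_adelicAct (g : GL (Fin 2) ℚ) (v : AdelicVector) :
    adelicAct g⁻¹ (adelicAct g v) = v := by
  ext1 p
  simp [adelicAct, ← localAct_mul, localAct_one]

lemma adelicAct_adelicAct_inv (g : GL (Fin 2) ℚ) (v : AdelicVector) :
    adelicAct g (adelicAct g⁻¹ v) = v := by
  ext1 p
  simp [adelicAct, ← localAct_mul, localAct_one]

lemma adelicAct_update (g : GL (Fin 2) ℚ) (v : AdelicVector) (p : Nat.Primes)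
    (a : Fin 2 → ℚ_[(p : ℕ)]) :
    adelicAct g (update v p a) = update (adelicAct g v) p (localAct p g a) := by
  ext1 l
  rcases eq_or_ne l p with rfl | h
  · simp [adelicAct]
  · simp [adelicAct, h]

lemma continuous_adelicAct (g : GL (Fin 2) ℚ) : Continuous (adelicAct g) := by
  unfold adelicAct localAct
  fun_prop

variable {G : Subgroup (GL (Fin 2) ℚ)}

lemma adelicAct_mem {g : GL (Fin 2) ℚ} (hg : g ∈ G) {v : AdelicVector} (hv : v ∈ orbitClosure G) :
    adelicAct g v ∈ orbitClosure G := by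
  refine map_mem_closure (continuous_adelicAct g) hv ?_
  rintro w ⟨h, hh, hw⟩
  refine ⟨g * h, G.mul_mem hg hh, fun p ↦ ?_⟩
  obtain ⟨c, hc, hwc⟩ := hw p
  exact ⟨c, hc, by rw [adelicAct, hwc, localAct_smul, localAct_mul]⟩

lemma adelicAct_mem_iff {g : GL (Fin 2) ℚ} (hg : g ∈ G) {v : AdelicVector} :
    adelicAct g v ∈ orbitClosure G ↔ v ∈ orbitClosure G :=
  ⟨fun h ↦ by simpa [adelicAct_inv_adelicAct] using adelicAct_mem (G.inv_mem hg) h,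
    adelicAct_mem hg⟩

lemma update_smul_mem {v : AdelicVector} (hv : v ∈ orbitClosure G) (p : Nat.Primes)
    {c : ℚ_[(p : ℕ)]} (hc : c ≠ 0) : update v p (c • v p) ∈ orbitClosure G := by
  refine map_mem_closure (f := fun v : AdelicVector ↦ update v p (c • v p))
    (continuous_id.update p (by fun_prop)) hv ?_
  rintro w ⟨g, hg, hw⟩
  refine ⟨g, hg, fun l ↦ ?_⟩
  rcases eq_or_ne l p with rfl | h
  · obtain ⟨d, hd, hwd⟩ := hw l
    exact ⟨c * d, mul_ne_zero hc hd, by simp [hwd, mul_smul]⟩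
  · simpa [h] using hw l

lemma single_mem_closure_range_intCast (p : Nat.Primes) (s : ℤ_[(p : ℕ)]) :
    (Pi.single p s : ∀ l : Nat.Primes, ℤ_[(l : ℕ)]) ∈
      closure (Set.range fun (n : ℤ) (l : Nat.Primes) ↦ (n : ℤ_[(l : ℕ)])) := by
  rw [mem_closure_iff]
  intro U hU hsU
  obtain ⟨I, u, hu, hI⟩ := isOpen_pi_iff.1 hU _ hsU
  have hk : ∀ l : Nat.Primes, ∃ k : ℕ, l ∈ I → l ≠ p →
      ∀ y : ℤ_[(l : ℕ)], ‖y‖ ≤ ((l : ℕ) : ℝ) ^ (-k : ℤ) → y ∈ u l := by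
    intro l
    by_cases hl : l ∈ I ∧ l ≠ p
    · obtain ⟨h1, h2⟩ := hu l hl.1
      rw [Pi.single_eq_of_ne hl.2] at h2
      obtain ⟨ε, hε, hb⟩ := Metric.isOpen_iff.1 h1 _ h2
      obtain ⟨k, hk⟩ := PadicInt.exists_pow_neg_lt (l : ℕ) hε
      exact ⟨k, fun _ _ y hy ↦ hb (by simpa using hy.trans_lt hk)⟩
    · exact ⟨0, fun h1 h2 ↦ absurd ⟨h1, h2⟩ hl⟩
  choose k hk using hk
  let N : ℕ := ∏ l ∈ I.erase p, (l : ℕ) ^ k l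
  have hNp : ‖(N : ℤ_[(p : ℕ)])‖ = 1 := by
    rw [PadicInt.norm_natCast_eq_one_iff]
    refine Nat.Coprime.prod_right fun l hl ↦ Nat.Coprime.pow_right _ ?_
    exact (Nat.coprime_primes p.2 l.2).2 fun h ↦ (Finset.ne_of_mem_erase hl) (Subtype.ext h.symm)
  have hm : ∃ m : ℤ, p ∈ I → ((N * m : ℤ) : ℤ_[(p : ℕ)]) ∈ u p := by
    by_cases hp : p ∈ I
    · obtain ⟨h1, h2⟩ := hu p hp
      rw [Pi.single_eq_same] at h2
      obtain ⟨c, hc⟩ := (PadicInt.isUnit_iff.2 hNp).exists_right_inv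
      obtain ⟨m, hm⟩ := PadicInt.denseRange_intCast.exists_mem_open
        (h1.preimage (f := fun y : ℤ_[(p : ℕ)] ↦ (N : ℤ_[(p : ℕ)]) * y) (by fun_prop))
        ⟨c * s, by simpa [← mul_assoc, hc] using h2⟩
      exact ⟨m, fun _ ↦ by simpa using hm⟩
    · exact ⟨0, fun h ↦ absurd h hp⟩
  obtain ⟨m, hm⟩ := hm
  refine ⟨_, hI ?_, ⟨N * m, rfl⟩⟩
  intro l hl
  rcases eq_or_ne l p with rfl | h
  · exact hm hl
  · refine hk l hl h _ ?_
    obtain ⟨d, hd⟩ := Finset.dvd_prod_of_mem (fun l : Nat.Primes ↦ (l : ℕ) ^ k l)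
      (Finset.mem_erase.2 ⟨h, hl⟩)
    have hN : N = (l : ℕ) ^ k l * d := hd
    rw [PadicInt.norm_le_pow_iff_mem_span_pow, Ideal.mem_span_singleton]
    exact ⟨d * m, by simp [hN, mul_assoc]⟩

/-- `G` contains the translations by the integer multiples of `2 t`. -/
def ContainsTranslations (G : Subgroup (GL (Fin 2) ℚ)) (t : ℚ) : Prop :=
  ∀ (n : ℤ) (g : GL (Fin 2) ℚ), g.val = !![1, 2 * t * n; 0, 1] → g ∈ G

lemma update_translate_mem {t : ℚ} (hT : ContainsTranslations G t) {v : AdelicVector}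
    (hv : v ∈ orbitClosure G) (p : Nat.Primes) (s : ℤ_[(p : ℕ)]) :
    update v p ![v p 0 + 2 * t * s * v p 1, v p 1] ∈ orbitClosure G := by
  let F : (∀ l : Nat.Primes, ℤ_[(l : ℕ)]) → AdelicVector :=
    fun σ l ↦ ![v l 0 + 2 * t * σ l * v l 1, v l 1]
  have hF : Continuous F := by
    refine continuous_pi fun l ↦ continuous_pi fun i ↦ ?_
    fin_cases i
    · simp only [F]; simp; fun_prop
    · simp only [F]; simp; fun_prop
  have hmem : F (Pi.single p s) ∈ closure (orbitClosure G) := by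
    refine map_mem_closure hF (single_mem_closure_range_intCast p s) ?_
    rintro _ ⟨n, rfl⟩
    let g : GL (Fin 2) ℚ := GeneralLinearGroup.mkOfDetNeZero !![1, 2 * t * n; 0, 1] (by simp)
    have hg : g.val = !![1, 2 * t * n; 0, 1] := rfl
    have h := adelicAct_mem (hT n g hg) hv
    convert h using 1
    ext1 l
    simp [F, adelicAct, localAct_apply, hg]
  rw [orbitClosure, closure_closure, ← orbitClosure] at hmem
  convert hmem using 1
  ext1 l
  rcases eq_or_ne l p with rfl | h
  · simp [F]
  · ext i
    fin_cases i <;> simp [F, h]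

/-- The vectors whose modification to `a` at `p` lies in the orbit closure. -/
def localClass (G : Subgroup (GL (Fin 2) ℚ)) (p : Nat.Primes) (a : Fin 2 → ℚ_[(p : ℕ)]) :
    Set AdelicVector :=
  {v | update v p a ∈ orbitClosure G}

/-- The translate of a set of vectors by `g`. -/
def setAct (g : GL (Fin 2) ℚ) (U : Set AdelicVector) : Set AdelicVector :=
  adelicAct g⁻¹ ⁻¹' U

lemma setAct_injective (g : GL (Fin 2) ℚ) : Injective (setAct g) :=
  Set.preimage_injective.2 fun v ↦ ⟨adelicAct g v, adelicAct_inv_adelicAct g v⟩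

lemma setAct_localClass {g : GL (Fin 2) ℚ} (hg : g ∈ G) (p : Nat.Primes)
    (a : Fin 2 → ℚ_[(p : ℕ)]) : setAct g (localClass G p a) = localClass G p (localAct p g a) := by
  ext v
  change update (adelicAct g⁻¹ v) p a ∈ orbitClosure G ↔
    update v p (localAct p g a) ∈ orbitClosure G
  rw [← adelicAct_mem_iff hg, adelicAct_update, adelicAct_adelicAct_inv]

lemma localClass_smul (p : Nat.Primes) {c : ℚ_[(p : ℕ)]} (hc : c ≠ 0) (a : Fin 2 → ℚ_[(p : ℕ)]) :
    localClass G p (c • a) = localClass G p a := by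
  ext v
  constructor
  · intro h
    simpa [localClass, smul_smul, inv_mul_cancel₀ hc] using update_smul_mem h p (inv_ne_zero hc)
  · intro h
    simpa [localClass] using update_smul_mem h p hc

lemma localClass_eq_of_norm_sub_le {t : ℚ} (ht : t ≠ 0) (hT : ContainsTranslations G t)
    (p : Nat.Primes) {z w : ℚ_[(p : ℕ)]} (h : ‖z - w‖ ≤ ‖2 * (t : ℚ_[(p : ℕ)])‖) :
    localClass G p ![z, 1] = localClass G p ![w, 1] := by
  have key : ∀ z w : ℚ_[(p : ℕ)], ‖z - w‖ ≤ ‖2 * (t : ℚ_[(p : ℕ)])‖ →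
      localClass G p ![w, 1] ⊆ localClass G p ![z, 1] := by
    intro z w h v hv
    have h2t : (2 * (t : ℚ_[(p : ℕ)])) ≠ 0 := mul_ne_zero two_ne_zero (by exact_mod_cast ht)
    have hs : ‖(z - w) / (2 * (t : ℚ_[(p : ℕ)]))‖ ≤ 1 := by
      rw [norm_div]
      exact div_le_one_of_le₀ h (norm_nonneg _)
    have := update_translate_mem hT hv p ⟨_, hs⟩
    have hzw : w + 2 * (t : ℚ_[(p : ℕ)]) * ((z - w) / (2 * t)) = z := by
      rw [mul_div_cancel₀ _ h2t, add_sub_cancel]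
    simpa [localClass, hzw] using this
  exact (key w z (by rwa [norm_sub_rev])).antisymm (key z w h)

lemma torusAction_localClass {t β : ℚ} (ht : t ≠ 0) (hT : ContainsTranslations G t)
    {A B : GL (Fin 2) ℚ} (hA : A.val = !![t, -β; 1, 0]) (hB : B.val = !![t - 1, β; 1, 1])
    (hβ : β ≠ 0) (hdet : t - 1 - β ≠ 0)
    (hAG : A ∈ G) (hBG : B ∈ G) (p : Nat.Primes) :
    TorusAction (t : ℚ_[(p : ℕ)]) (β : ℚ_[(p : ℕ)]) (setAct A) (setAct B)
      (fun z ↦ localClass G p ![z, 1]) (localClass G p ![1, 0]) where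
  inj := setAct_injective A
  translate z w h := localClass_eq_of_norm_sub_le ht hT p h
  a_infty := by
    rw [setAct_localClass hAG, localAct_apply, hA]
    simp
  a_zero := by
    have hc : (-β : ℚ_[(p : ℕ)]) ≠ 0 := neg_ne_zero.2 (by exact_mod_cast hβ)
    rw [setAct_localClass hAG, ← localClass_smul p hc ![1, 0], localAct_apply, hA]
    simp
  a_apply z hz := by
    rw [setAct_localClass hAG, ← localClass_smul p hz ![_, 1], localAct_apply, hA]
    have hβz : z * ((t : ℚ_[(p : ℕ)]) + -(β / z)) = t * z + -β := by field_simp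
    simp [hβz, sub_eq_add_neg]
  b_infty := by
    rw [setAct_localClass hBG, localAct_apply, hB]
    simp
  b_neg_one := by
    have hc : (-(t - 1 - β : ℚ) : ℚ_[(p : ℕ)]) ≠ 0 := neg_ne_zero.2 (by exact_mod_cast hdet)
    rw [setAct_localClass hBG, ← localClass_smul p hc ![1, 0], localAct_apply, hB]
    simp
    ring_nf

lemma iterate_setAct_localClass {g : GL (Fin 2) ℚ} (hg : g ∈ G) (p : Nat.Primes) (i : ℕ)
    (a : Fin 2 → ℚ_[(p : ℕ)]) :
    (setAct g)^[i] (localClass G p a) = localClass G p (localAct p (g ^ i) a) := by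
  induction i with
  | zero => simp [localAct_one]
  | succ i ih => rw [iterate_succ_apply', ih, setAct_localClass hg, pow_succ', localAct_mul]

lemma mem_orbitClosure_of_localClass_eq {g : GL (Fin 2) ℚ} (hg : g ∈ G) {v : AdelicVector}
    (h : ∀ p, localClass G p (v p) = localClass G p (localAct p g ![1, 0])) :
    v ∈ orbitClosure G := by
  classical
  let w : Finset Nat.Primes → AdelicVector :=
    fun S p ↦ if p ∈ S then v p else localAct p g ![1, 0]
  have hw : ∀ S, w S ∈ orbitClosure G := by
    intro S
    induction S using Finset.induction_on with
    | empty => exact subset_closure ⟨g, hg, fun p ↦ ⟨1, one_ne_zero, by simp [w]⟩⟩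
    | insert p S hp ih =>
      have h1 : w (insert p S) = update (w S) p (v p) := by
        ext1 l
        rcases eq_or_ne l p with rfl | hl
        · simp [w]
        · simp [w, hl]
      have h2 : update (w S) p (localAct p g ![1, 0]) = w S := by
        rw [update_eq_self_iff]
        simp [w, hp]
      have h3 : w S ∈ localClass G p (v p) := by
        rw [h p]
        simpa [localClass, h2] using ih
      rw [h1]
      exact h3
  refine isClosed_closure.mem_of_tendsto (b := Filter.atTop) (f := w) ?_ (.of_forall hw)
  refine tendsto_pi_nhds.2 fun p ↦ tendsto_const_nhds.congr' ?_
  filter_upwards [Filter.eventually_ge_atTop {p}] with S hS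
  simp [w, Finset.singleton_subset_iff.1 hS]

lemma CyclicClasses.iterate_eq {K Q : Type*} {a b : Q → Q} {f : K → Q} {o : Q} {n m : ℕ}
    (h : CyclicClasses a b f o n m) {i j k : ℕ} (hj : j < 2) (hijk : i + m * j ≡ k [MOD n]) :
    a^[k] o = a^[i] (b^[j] o) := by
  have hb : b^[j] o = a^[m * j] o := by
    interval_cases j
    · simp
    · simp [h.b_infty]
  have hper : IsPeriodicPt a n o := h.period
  rw [hb, ← iterate_add_apply, ← hper.iterate_mod_apply, ← hijk, hper.iterate_mod_apply]

lemma mem_closure_quotients {x : ∀ p : Nat.Primes, ℚ_[(p : ℕ)]}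
    (hx : (fun p ↦ ![x p, 1] : AdelicVector) ∈ orbitClosure G) :
    x ∈ closure ((fun (y : ℚ) (p : Nat.Primes) ↦ (y : ℚ_[(p : ℕ)])) ''
      {y | ∃ g ∈ G, g.val 1 0 ≠ 0 ∧ y = g.val 0 0 / g.val 1 0}) := by
  let p₀ : Nat.Primes := ⟨2, Nat.prime_two⟩
  have hopen : IsOpen {v : AdelicVector | v p₀ 1 ≠ 0} :=
    isOpen_ne_fun (by fun_prop) continuous_const
  have hx' := hopen.inter_closure ⟨by simp, hx⟩
  have hcont : ContinuousAt (fun (v : AdelicVector) (p : Nat.Primes) ↦ v p 0 / v p 1)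
      (fun p ↦ ![x p, 1]) := by
    refine continuousAt_pi.2 fun p ↦ ContinuousAt.div ?_ ?_ (by simp)
    · exact (Continuous.continuousAt (by fun_prop))
    · exact (Continuous.continuousAt (by fun_prop))
  have := mem_closure_image hcont hx'
  simp only [Matrix.cons_val_zero, Matrix.cons_val_one, div_one] at this
  refine closure_mono ?_ this
  rintro _ ⟨v, ⟨hv, g, hg, hgv⟩, rfl⟩
  have h10 : g.val 1 0 ≠ 0 := by
    intro h0
    obtain ⟨c, hc, hvc⟩ := hgv p₀
    apply hv
    simp [hvc, localAct_apply, h0]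
  refine ⟨_, ⟨g, hg, h10, rfl⟩, ?_⟩
  ext1 p
  obtain ⟨c, hc, hvc⟩ := hgv p
  simp [hvc, localAct_apply, mul_div_mul_left _ _ hc]

end AdelicClosure

section ProductFormula

open Function

variable {G : Subgroup (GL (Fin 2) ℚ)}

/-- `β` is an integer away from `q`, has a simple pole at `q`, and vanishes modulo `t`. -/
structure DenominatorConditions (t q : ℕ) (β : ℚ) : Prop where
  norm_eq : ∀ p : Nat.Primes, (p : ℕ) = q → ‖(β : ℚ_[(p : ℕ)])‖ = (p : ℕ)
  norm_le : ∀ p : Nat.Primes, (p : ℕ) ≠ q → ‖(β : ℚ_[(p : ℕ)])‖ ≤ 1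
  norm_lt : ∀ p : Nat.Primes, (p : ℕ) = t → ‖(β : ℚ_[(p : ℕ)])‖ < 1

lemma mem_orbitClosure_of_cyclicClasses {A B : GL (Fin 2) ℚ} (hA : A ∈ G) (hB : B ∈ G)
    {x : ∀ p : Nat.Primes, ℚ_[(p : ℕ)]} (i j : ℕ) (hj : j < 2)
    (h : ∀ p : Nat.Primes, ∃ n m k, CyclicClasses (setAct A) (setAct B)
      (fun z ↦ localClass G p ![z, 1]) (localClass G p ![1, 0]) n m ∧
      localClass G p ![x p, 1] = (setAct A)^[k] (localClass G p ![1, 0]) ∧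
      i + m * j ≡ k [MOD n]) :
    (fun p ↦ ![x p, 1] : AdelicVector) ∈ orbitClosure G := by
  refine mem_orbitClosure_of_localClass_eq
    (G.mul_mem (G.pow_mem hA i) (G.pow_mem hB j)) fun p ↦ ?_
  obtain ⟨n, m, k, hC, hk, hijk⟩ := h p
  rw [hk, hC.iterate_eq hj hijk, iterate_setAct_localClass hB, iterate_setAct_localClass hA,
    localAct_mul]

lemma norm_natCast_eq_one {p l : ℕ} [hp : Fact p.Prime] (hl : l.Prime) (h : p ≠ l) :
    ‖(l : ℚ_[p])‖ = 1 := by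
  rw [Padic.norm_natCast_eq_one_iff]
  exact (Nat.coprime_primes hp.out hl).2 h

theorem mem_closure_quotients_of_denominatorConditions {t q : ℕ} (ht : t.Prime) (hq : q.Prime)
    (hqt : q ≠ t) {β : ℚ} (hβ : DenominatorConditions t q β) (hβ0 : β ≠ 0)
    (hdet : (t : ℚ) - 1 - β ≠ 0) (hT : ContainsTranslations G t) {A B : GL (Fin 2) ℚ}
    (hA : A.val = !![(t : ℚ), -β; 1, 0]) (hB : B.val = !![(t : ℚ) - 1, β; 1, 1])
    (hAG : A ∈ G) (hBG : B ∈ G) (x : ∀ p : Nat.Primes, ℚ_[(p : ℕ)]) :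
    x ∈ closure ((fun (y : ℚ) (p : Nat.Primes) ↦ (y : ℚ_[(p : ℕ)])) ''
      {y | ∃ g ∈ G, g.val 1 0 ≠ 0 ∧ y = g.val 0 0 / g.val 1 0}) := by
  refine mem_closure_quotients ?_
  have hact : ∀ p : Nat.Primes, TorusAction (t : ℚ_[(p : ℕ)]) (β : ℚ_[(p : ℕ)]) (setAct A)
      (setAct B) (fun z ↦ localClass G p ![z, 1]) (localClass G p ![1, 0]) := fun p ↦ by
    simpa using torusAction_localClass (Nat.cast_ne_zero.2 ht.ne_zero) hT hA hB hβ0 hdet hAG hBG p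
  have h2 : ∀ p : Nat.Primes, (p : ℕ) ≠ 2 → ‖(2 : ℚ_[(p : ℕ)])‖ = 1 := fun p hp ↦ by
    simpa using norm_natCast_eq_one Nat.prime_two hp
  have ht1 : ∀ p : Nat.Primes, (p : ℕ) ≠ t → ‖(t : ℚ_[(p : ℕ)])‖ = 1 := fun p hp ↦
    norm_natCast_eq_one ht hp
  let C (p : Nat.Primes) (n m : ℕ) : Prop := CyclicClasses (setAct A) (setAct B)
    (fun z ↦ localClass G p ![z, 1]) (localClass G p ![1, 0]) n m
  have hgen : ∀ p : Nat.Primes, (p : ℕ) ≠ 2 → (p : ℕ) ≠ t → (p : ℕ) ≠ q → C p 1 0 :=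
    fun p hp2 hpt hpq ↦ (hact p).cyclicClasses_of_unit
      (by rw [norm_mul, h2 p hp2, ht1 p hpt, one_mul]) (hβ.norm_le p hpq)
  have hden : ∀ p : Nat.Primes, (p : ℕ) ≠ 2 → (p : ℕ) = q → C p 2 1 :=
    fun p hp2 hpq ↦ (hact p).cyclicClasses_of_denominator (h2 p hp2)
      (ht1 p (hpq ▸ hqt)) (hβ.norm_eq p hpq)
  have hdvd : ∀ p : Nat.Primes, (p : ℕ) ≠ 2 → (p : ℕ) = t → C p 2 0 :=
    fun p hp2 hpt ↦ (hact p).cyclicClasses_of_dvd (h2 p hp2)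
      (by rw [← hpt, Padic.norm_p]) (hβ.norm_lt p hpt)
  let p₂ : Nat.Primes := ⟨2, Nat.prime_two⟩
  let pt : Nat.Primes := ⟨t, ht⟩
  let pq : Nat.Primes := ⟨q, hq⟩
  rcases eq_or_ne t 2 with rfl | ht2
  · have hC₂ : C p₂ 4 2 ∨ C p₂ 3 0 := TorusAction.cyclicClasses_two_of_two
      (by simpa using hact p₂) (by exact_mod_cast hβ0) (hβ.norm_lt p₂ rfl)
    have hCq : C pq 2 1 := hden pq hqt rfl
    obtain ⟨w, hw⟩ := hCq.cover (x pq)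
    rcases hC₂ with hC₂ | hC₂
    · obtain ⟨r, hr⟩ := hC₂.cover (x p₂)
      refine mem_orbitClosure_of_cyclicClasses hAG hBG (r + 2 * ((r + w) % 2)) ((r + w) % 2)
        (by omega) fun p ↦ ?_
      by_cases hp2 : (p : ℕ) = 2
      · obtain rfl : p = p₂ := Subtype.ext hp2
        exact ⟨4, 2, r, hC₂, hr, by rw [Nat.ModEq]; omega⟩
      by_cases hpq : (p : ℕ) = q
      · obtain rfl : p = pq := Subtype.ext hpq
        exact ⟨2, 1, w, hCq, hw, by rw [Nat.ModEq]; omega⟩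
      have hC := hgen p hp2 hp2 hpq
      obtain ⟨k, hk⟩ := hC.cover (x p)
      exact ⟨1, 0, k, hC, hk, Nat.modEq_one⟩
    · obtain ⟨r, hr⟩ := hC₂.cover (x p₂)
      refine mem_orbitClosure_of_cyclicClasses hAG hBG r ((r + w) % 2) (by omega) fun p ↦ ?_
      by_cases hp2 : (p : ℕ) = 2
      · obtain rfl : p = p₂ := Subtype.ext hp2
        exact ⟨3, 0, r, hC₂, hr, by rw [Nat.ModEq]; omega⟩
      by_cases hpq : (p : ℕ) = q
      · obtain rfl : p = pq := Subtype.ext hpq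
        exact ⟨2, 1, w, hCq, hw, by rw [Nat.ModEq]; omega⟩
      have hC := hgen p hp2 hp2 hpq
      obtain ⟨k, hk⟩ := hC.cover (x p)
      exact ⟨1, 0, k, hC, hk, Nat.modEq_one⟩
  have hCt : C pt 2 0 := hdvd pt ht2 rfl
  obtain ⟨s, hs⟩ := hCt.cover (x pt)
  rcases eq_or_ne q 2 with rfl | hq2
  · have hC₂ : C p₂ 4 3 := TorusAction.cyclicClasses_two_of_denominator (hact p₂)
      (ht1 p₂ hqt) (hβ.norm_eq p₂ rfl)
    obtain ⟨r, hr⟩ := hC₂.cover (x p₂)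
    refine mem_orbitClosure_of_cyclicClasses hAG hBG (r + (r + s) % 2) ((r + s) % 2)
      (by omega) fun p ↦ ?_
    by_cases hp2 : (p : ℕ) = 2
    · obtain rfl : p = p₂ := Subtype.ext hp2
      exact ⟨4, 3, r, hC₂, hr, by rw [Nat.ModEq]; omega⟩
    by_cases hpt : (p : ℕ) = t
    · obtain rfl : p = pt := Subtype.ext hpt
      exact ⟨2, 0, s, hCt, hs, by rw [Nat.ModEq]; omega⟩
    have hC := hgen p hp2 hpt hp2
    obtain ⟨k, hk⟩ := hC.cover (x p)
    exact ⟨1, 0, k, hC, hk, Nat.modEq_one⟩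
  · have hC₂ : C p₂ 3 2 := TorusAction.cyclicClasses_two_of_odd (hact p₂)
      (ht1 p₂ ht2.symm) (hβ.norm_le p₂ hq2.symm)
    have hCq : C pq 2 1 := hden pq hq2 rfl
    obtain ⟨r, hr⟩ := hC₂.cover (x p₂)
    obtain ⟨w, hw⟩ := hCq.cover (x pq)
    refine mem_orbitClosure_of_cyclicClasses hAG hBG (4 * (r + (s + w) % 2) + 3 * s)
      ((s + w) % 2) (by omega) fun p ↦ ?_
    by_cases hp2 : (p : ℕ) = 2
    · obtain rfl : p = p₂ := Subtype.ext hp2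
      exact ⟨3, 2, r, hC₂, hr, by rw [Nat.ModEq]; omega⟩
    by_cases hpt : (p : ℕ) = t
    · obtain rfl : p = pt := Subtype.ext hpt
      exact ⟨2, 0, s, hCt, hs, by rw [Nat.ModEq]; omega⟩
    by_cases hpq : (p : ℕ) = q
    · obtain rfl : p = pq := Subtype.ext hpq
      exact ⟨2, 1, w, hCq, hw, by rw [Nat.ModEq]; omega⟩
    have hC := hgen p hp2 hpt hpq
    obtain ⟨k, hk⟩ := hC.cover (x p)
    exact ⟨1, 0, k, hC, hk, Nat.modEq_one⟩

end ProductFormula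

section Cusps

variable {G : Subgroup (GL (Fin 2) ℚ)}

lemma mem_of_val_eq_smul (hG : Subgroup.center (GL (Fin 2) ℚ) ≤ G) {g h : GL (Fin 2) ℚ} {c : ℚ}
    (hh : h ∈ G) (hgh : g.val = c • h.val) : g ∈ G := by
  have hc : g * h⁻¹ ∈ Subgroup.center (GL (Fin 2) ℚ) := by
    refine GeneralLinearGroup.mem_center_iff_val_mem_range_scalar.2 ⟨c, ?_⟩
    rw [Units.val_mul, hgh, smul_mul_assoc, Units.mul_inv, scalar_apply, smul_one_eq_diagonal]
  exact (G.mul_mem_cancel_right (G.inv_mem hh)).1 (hG hc)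

lemma containsTranslations_of_mem {t : ℚ} {u : GL (Fin 2) ℚ} (hu : u.val = !![1, 2 * t; 0, 1])
    (huG : u ∈ G) : ContainsTranslations G t := by
  have hpow : ∀ n : ℕ, (u ^ n).val = !![1, 2 * t * n; 0, 1] := by
    intro n
    induction n with
    | zero => simp [← one_fin_two]
    | succ n ih =>
      rw [pow_succ, Units.val_mul, ih, hu]
      simp [mul_add, add_comm]
  intro n g hg
  obtain ⟨m, rfl | rfl⟩ := n.eq_nat_or_neg
  · have : g = u ^ m := Units.ext (by rw [hg, hpow]; simp)
    exact this ▸ G.pow_mem huG m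
  · have : g * u ^ m = 1 := Units.ext (by rw [Units.val_mul, hg, hpow]; simp [← one_fin_two])
    rw [eq_inv_of_mul_eq_one_left this]
    exact G.inv_mem (G.pow_mem huG m)

lemma DenominatorConditions.swap {t q : ℕ} {β : ℚ}
    (hq : ∀ p : Nat.Primes, (p : ℕ) = q → ‖(β : ℚ_[(p : ℕ)])‖ = (p : ℕ))
    (hle : ∀ p : Nat.Primes, (p : ℕ) ≠ q → ‖(β : ℚ_[(p : ℕ)])‖ ≤ 1)
    (hlt : ∀ p : Nat.Primes, (p : ℕ) = t → ‖((β + 1 : ℚ) : ℚ_[(p : ℕ)])‖ < 1) :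
    DenominatorConditions t q ((t : ℚ) - 1 - β) where
  norm_eq p hp := by
    have h1 : ‖((((t : ℤ) - 1 : ℤ)) : ℚ_[(p : ℕ)])‖ ≤ 1 := Padic.norm_int_le_one _
    have h2 := hq p hp
    have h3 : (1 : ℝ) < (p : ℕ) := by exact_mod_cast p.2.one_lt
    push_cast at h1 ⊢
    rw [norm_sub_eq_right (by linarith), h2]
  norm_le p hp := by
    have h1 : ‖((((t : ℤ) - 1 : ℤ)) : ℚ_[(p : ℕ)])‖ ≤ 1 := Padic.norm_int_le_one _
    push_cast at h1 ⊢
    exact padicNorm_sub_le h1 (hle p hp)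
  norm_lt p hp := by
    have h1 : ‖(t : ℚ_[(p : ℕ)])‖ < 1 := by rw [← hp]; exact Padic.norm_p_lt_one
    have h2 := hlt p hp
    have h3 : (((t : ℚ) - 1 - β : ℚ) : ℚ_[(p : ℕ)]) = t - ((β + 1 : ℚ) : ℚ_[(p : ℕ)]) := by
      push_cast
      ring
    rw [h3]
    exact (padicNorm_sub_le (le_max_left _ _) (le_max_right _ _)).trans_lt (max_lt h1 h2)

/-- Conjugation by the involution `x ↦ t - 1 - x` exchanges the roles of `β` and `t - 1 - β`. -/
theorem mem_closure_quotients_of_swap {t q : ℕ} (ht : t.Prime) (hq : q.Prime)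
    (hqt : q ≠ t) {β : ℚ} (hβ : DenominatorConditions t q ((t : ℚ) - 1 - β)) (hβ0 : β ≠ 0)
    (hdet : (t : ℚ) - 1 - β ≠ 0) (hG : Subgroup.center (GL (Fin 2) ℚ) ≤ G)
    (hT : ContainsTranslations G t) {A B : GL (Fin 2) ℚ}
    (hA : A.val = !![(t : ℚ), -β; 1, 0]) (hB : B.val = !![(t : ℚ) - 1, β; 1, 1])
    (hAG : A ∈ G) (hBG : B ∈ G) (x : ∀ p : Nat.Primes, ℚ_[(p : ℕ)]) :
    x ∈ closure ((fun (y : ℚ) (p : Nat.Primes) ↦ (y : ℚ_[(p : ℕ)])) ''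
      {y | ∃ g ∈ G, g.val 1 0 ≠ 0 ∧ y = g.val 0 0 / g.val 1 0}) := by
  have hdetι : (!![-1, (t : ℚ) - 1; 0, 1]).det ≠ 0 := by simp
  let ι : GL (Fin 2) ℚ := GeneralLinearGroup.mkOfDetNeZero !![-1, (t : ℚ) - 1; 0, 1] hdetι
  have hι : ι.val = !![-1, (t : ℚ) - 1; 0, 1] := rfl
  have hιι : ι * ι = 1 := Units.ext (by rw [Units.val_mul, hι]; simp [← one_fin_two])
  have hιinv : ι⁻¹ = ι := inv_eq_of_mul_eq_one_left hιι
  let G' : Subgroup (GL (Fin 2) ℚ) := G.comap (MulAut.conj ι).toMonoidHom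
  have hmem : ∀ g, g ∈ G' ↔ ι * g * ι ∈ G := fun g ↦ by
    simp [G', Subgroup.mem_comap, MulAut.conj_apply, hιinv]
  let A' : GL (Fin 2) ℚ := GeneralLinearGroup.mkOfDetNeZero
    !![(t : ℚ), -((t : ℚ) - 1 - β); 1, 0] (by simpa using hdet)
  let B' : GL (Fin 2) ℚ := GeneralLinearGroup.mkOfDetNeZero
    !![(t : ℚ) - 1, (t : ℚ) - 1 - β; 1, 1] (by simpa using hβ0)
  have hA' : A'.val = !![(t : ℚ), -((t : ℚ) - 1 - β); 1, 0] := rfl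
  have hB' : B'.val = !![(t : ℚ) - 1, (t : ℚ) - 1 - β; 1, 1] := rfl
  have hA'G : A' ∈ G' := by
    rw [hmem, ← G.mul_mem_cancel_right hBG]
    refine mem_of_val_eq_smul (c := (t : ℚ) - 1 - β) hG G.one_mem ?_
    simp only [Units.val_mul, hι, hA', hB, Units.val_one]
    ext i j
    fin_cases i <;> fin_cases j <;> simp <;> ring
  have hB'G : B' ∈ G' := by
    rw [hmem, ← G.mul_mem_cancel_right hAG]
    refine mem_of_val_eq_smul (c := β) hG G.one_mem ?_
    simp only [Units.val_mul, hι, hB', hA, Units.val_one]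
    ext i j
    fin_cases i <;> fin_cases j <;> simp
  have hT' : ContainsTranslations G' t := by
    intro n g hg
    rw [hmem]
    refine hT (-n) _ ?_
    simp only [Units.val_mul, hι, hg]
    ext i j
    fin_cases i <;> fin_cases j <;> simp
    ring
  have hcore := mem_closure_quotients_of_denominatorConditions ht hq hqt hβ hdet
    (by simpa using hβ0) hT' hA' hB' hA'G hB'G (fun p ↦ (t : ℚ_[(p : ℕ)]) - 1 - x p)
  have hcont : Continuous fun (y : ∀ p : Nat.Primes, ℚ_[(p : ℕ)]) (p : Nat.Primes) ↦
      (t : ℚ_[(p : ℕ)]) - 1 - y p := by fun_prop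
  have hx := map_mem_closure hcont hcore (t := (fun (y : ℚ) (p : Nat.Primes) ↦
    (y : ℚ_[(p : ℕ)])) '' {y | ∃ g ∈ G, g.val 1 0 ≠ 0 ∧ y = g.val 0 0 / g.val 1 0}) ?_
  · simpa using hx
  rintro _ ⟨_, ⟨g, hg, hg0, rfl⟩, rfl⟩
  have hval : (ι * g * ι).val 0 0 = g.val 0 0 - (t - 1) * g.val 1 0 ∧
      (ι * g * ι).val 1 0 = -g.val 1 0 := by
    rw [Units.val_mul, Units.val_mul, hι, eta_fin_two g.val]
    constructor
    · simp
      ring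
    · simp
  refine ⟨(t : ℚ) - 1 - g.val 0 0 / g.val 1 0, ⟨ι * g * ι, (hmem g).1 hg, ?_, ?_⟩, ?_⟩
  · rw [hval.2]
    exact neg_ne_zero.2 hg0
  · rw [hval.1, hval.2]
    field_simp
    ring
  · ext1 p
    push_cast
    rfl

lemma quotient_mem_finiteCusps {Γ : Subgroup PGL2Q} {t : ℚ} (ht : t ≠ 0)
    (hT : ContainsTranslations (Γ.comap pgl) t) {g : GL (Fin 2) ℚ} (hg : g ∈ Γ.comap pgl)
    (h0 : g.val 1 0 ≠ 0) : g.val 0 0 / g.val 1 0 ∈ finiteCusps Γ := by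
  let u : GL (Fin 2) ℚ := GeneralLinearGroup.mkOfDetNeZero !![1, 2 * t; 0, 1] (by simp)
  have hu : u.val = !![1, 2 * t; 0, 1] := rfl
  have huG : u ∈ Γ.comap pgl := hT 1 u (by simp [hu])
  have hd : g.val.det ≠ 0 := g.det.ne_zero
  set d := g.val.det with hd_def
  set a := g.val 0 0 with ha
  set b := g.val 1 0 with hb
  have hval : (g * u * g⁻¹).val =
      !![1 - 2 * t * a * b / d, 2 * t * a ^ 2 / d; -(2 * t * b ^ 2 / d), 1 + 2 * t * a * b / d] := by
    rw [Units.val_mul, Units.mul_inv_eq_iff_eq_mul, Units.val_mul, hu]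
    rw [det_fin_two, ← ha, ← hb] at hd_def
    rw [eta_fin_two g.val, ← ha, ← hb]
    ext i j
    fin_cases i <;> fin_cases j <;> simp <;> field_simp <;> rw [hd_def] <;> ring
  refine ⟨g * u * g⁻¹, ?_, ?_, ?_, ?_⟩
  · exact (Γ.comap pgl).mul_mem ((Γ.comap pgl).mul_mem hg huG) ((Γ.comap pgl).inv_mem hg)
  · intro h
    have hc : g * u * g⁻¹ ∈ Subgroup.center (GL (Fin 2) ℚ) := (QuotientGroup.eq_one_iff _).1 h
    obtain ⟨c, hc⟩ := GeneralLinearGroup.mem_center_iff_val_mem_range_scalar.1 hc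
    have h10 := congrFun (congrFun hc 1) 0
    rw [hval] at h10
    simp [ht, h0, hd] at h10
  · rw [hval]
    simp [trace_fin_two, det_fin_two]
    ring
  · have hden : -(2 * t * b ^ 2 / d) * (a / b) + (1 + 2 * t * a * b / d) = 1 := by
      field_simp
      ring
    have hnum : (1 - 2 * t * a * b / d) * (a / b) + 2 * t * a ^ 2 / d = a / b := by
      field_simp
      ring
    change (if _ then _ else _) = _
    rw [hval]
    simp only [of_apply, cons_val', cons_val_zero, cons_val_one, cons_val_fin_one]
    rw [hden, hnum, if_neg one_ne_zero, div_one]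

lemma denominatorConditions_or {t : ℕ} (ht : t.Prime) {β : ℚ} (hβ0 : 0 < β) (hden : β.den.Prime)
    (hcong : 0 < padicValRat t β ∨ 0 < padicValRat t (β + 1)) :
    DenominatorConditions t β.den β ∨ DenominatorConditions t β.den ((t : ℚ) - 1 - β) := by
  have hlt : ∀ (p : Nat.Primes) (r : ℚ), (p : ℕ) = t → 0 < r → 0 < padicValRat t r →
      ‖(r : ℚ_[(p : ℕ)])‖ < 1 := by
    rintro p r rfl hr hv
    rw [Padic.norm_eq_zpow_neg_valuation (by exact_mod_cast hr.ne'), Padic.valuation_ratCast]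
    exact zpow_lt_one_of_neg₀ (by exact_mod_cast p.2.one_lt) (by omega)
  have hle : ∀ p : Nat.Primes, (p : ℕ) ≠ β.den → ‖(β : ℚ_[(p : ℕ)])‖ ≤ 1 := fun p hp ↦
    Padic.norm_rat_le_one fun h ↦ hp ((Nat.prime_dvd_prime_iff_eq p.2 hden).1 h)
  have hq : ∀ p : Nat.Primes, (p : ℕ) = β.den → ‖(β : ℚ_[(p : ℕ)])‖ = (p : ℕ) := by
    intro p hp
    have hnum : ‖((β.num : ℤ) : ℚ_[(p : ℕ)])‖ = 1 := by
      rw [Padic.norm_intCast_eq_one_iff, Int.isCoprime_iff_gcd_eq_one, hp]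
      exact β.reduced
    rw [Rat.cast_def, norm_div, hnum, ← hp, Padic.norm_p, one_div, inv_inv]
  rcases hcong with h | h
  · exact .inl ⟨hq, hle, fun p hp ↦ hlt p β hp hβ0 h⟩
  · exact .inr (.swap hq hle fun p hp ↦ hlt p (β + 1) hp (by positivity) h)

end Cusps

/-- **Proposition 6, second part.** Let `t` be prime, `0 < u² < t − 1`, the
denominator of `u²` a prime different from `t`, and `u² ≡ 0` or `−1 (mod t)`. Then the finite
cusp set of `Δ(u²,2t)` is dense in the product `∏_p ℚ_p` over all primes, with the product
topology. -/
theorem cusps_dense_prod_all_padic (t : ℕ) (ht : t.Prime) (u2 : ℚ)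
    (h0 : 0 < u2) (h1 : u2 < (t : ℚ) - 1)
    (hden : u2.den.Prime) (hden' : u2.den ≠ t)
    (hcong : 0 < padicValRat t u2 ∨ 0 < padicValRat t (u2 + 1)) :
    Dense ((fun x : ℚ => fun p : Nat.Primes => (x : ℚ_[(p : ℕ)])) ''
      finiteCusps (Delta u2 (t : ℚ))) := by
  let G : Subgroup (GL (Fin 2) ℚ) := (Delta u2 t).comap pgl
  have hG : Subgroup.center (GL (Fin 2) ℚ) ≤ G := fun g hg ↦ by
    have : pgl g = 1 := (QuotientGroup.eq_one_iff g).2 hg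
    simp [G, Subgroup.mem_comap, this]
  have hdet : (t : ℚ) - 1 - u2 ≠ 0 := (sub_pos.2 h1).ne'
  let A : GL (Fin 2) ℚ := GeneralLinearGroup.mkOfDetNeZero !![(t : ℚ), -u2; 1, 0]
    (by simpa using h0.ne')
  let M₁ : GL (Fin 2) ℚ := GeneralLinearGroup.mkOfDetNeZero !![(t : ℚ) - 1, u2; 1, 1]
    (by simpa using hdet)
  let M₂ : GL (Fin 2) ℚ := GeneralLinearGroup.mkOfDetNeZero !![u2, u2; 1, (t : ℚ) - u2] (by
    have : u2 * (t - u2) - u2 = u2 * (t - 1 - u2) := by ring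
    simpa [this] using ⟨h0.ne', hdet⟩)
  let U : GL (Fin 2) ℚ := GeneralLinearGroup.mkOfDetNeZero !![1, 2 * (t : ℚ); 0, 1] (by simp)
  have hA : A.val = !![(t : ℚ), -u2; 1, 0] := rfl
  have hM₁ : M₁.val = !![(t : ℚ) - 1, u2; 1, 1] := rfl
  have hM₂ : M₂.val = !![u2, u2; 1, (t : ℚ) - u2] := rfl
  have hU : U.val = !![1, 2 * (t : ℚ); 0, 1] := rfl
  have hM₁G : M₁ ∈ G := Subgroup.subset_closure ⟨M₁, .inl hM₁, rfl⟩
  have hM₂G : M₂ ∈ G := Subgroup.subset_closure ⟨M₂, .inr hM₂, rfl⟩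
  have hAG : A ∈ G := by
    rw [← G.mul_mem_cancel_right hM₂G]
    refine mem_of_val_eq_smul (c := u2) hG hM₁G ?_
    simp only [Units.val_mul, hA, hM₁, hM₂]
    ext i j
    fin_cases i <;> fin_cases j <;> simp <;> ring
  have hUG : U ∈ G := by
    let V : GL (Fin 2) ℚ := GeneralLinearGroup.mkOfDetNeZero !![1, -(2 * (t : ℚ)); 0, 1] (by simp)
    have hV : V.val = !![1, -(2 * (t : ℚ)); 0, 1] := rfl
    have hUV : U * V = 1 := Units.ext (by rw [Units.val_mul, hU, hV]; simp [← one_fin_two])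
    rw [eq_inv_of_mul_eq_one_left hUV, inv_mem_iff, ← G.mul_mem_cancel_left hM₂G,
      ← G.mul_mem_cancel_right hM₁G]
    refine mem_of_val_eq_smul (c := -1) hG (G.mul_mem hM₁G hM₂G) ?_
    simp only [Units.val_mul, hV, hM₁, hM₂]
    ext i j
    fin_cases i <;> fin_cases j <;> simp <;> ring
  have hT : ContainsTranslations G t := containsTranslations_of_mem hU hUG
  have hsub : {y | ∃ g ∈ G, g.val 1 0 ≠ 0 ∧ y = g.val 0 0 / g.val 1 0} ⊆
      finiteCusps (Delta u2 t) := by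
    rintro _ ⟨g, hg, hg0, rfl⟩
    exact quotient_mem_finiteCusps (Nat.cast_ne_zero.2 ht.ne_zero) hT hg hg0
  intro x
  refine closure_mono (Set.image_mono hsub) ?_
  rcases denominatorConditions_or ht h0 hden hcong with hβ | hβ
  · exact mem_closure_quotients_of_denominatorConditions ht hden hden' hβ h0.ne' hdet hT hA hM₁
      hAG hM₁G x
  · exact mem_closure_quotients_of_swap ht hden hden' hβ h0.ne' hdet hG hT hA hM₁ hAG hM₁G x
end

section
/- For u² = 6/11 and t = 3 (so 0 < 6/11 < 2), the image of the finite cusp set C(Δ(6/11, 6)) under the diagonal embedding of ℚ into the product ∏_p ℚ_p over all primes p, equipped with the product topology, is dense. -/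
open Matrix

open Filter Topology
open scoped MatrixGroups

/-- The unipotent matrix `1 + s · v (v^⊥)ᵀ`, which fixes the vector `v`. -/
def parab {R : Type*} [CommRing R] (v : Fin 2 → R) (s : R) : SL(2, R) :=
  ⟨!![1 - s * v 0 * v 1, s * v 0 ^ 2; -(s * v 1 ^ 2), 1 + s * v 0 * v 1], by
    rw [det_fin_two_of]; ring⟩

section Parab

variable {R : Type*} [CommRing R]

lemma coe_parab (v : Fin 2 → R) (s : R) : (parab v s : Matrix (Fin 2) (Fin 2) R) =
    !![1 - s * v 0 * v 1, s * v 0 ^ 2; -(s * v 1 ^ 2), 1 + s * v 0 * v 1] := rfl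

lemma parab_add (v : Fin 2 → R) (s t : R) : parab v (s + t) = parab v s * parab v t := by
  ext i j
  fin_cases i <;> fin_cases j <;> simp [coe_parab, Matrix.mul_apply, Fin.sum_univ_two] <;> ring

lemma parab_zero (v : Fin 2 → R) : parab v 0 = 1 := by
  ext i j
  fin_cases i <;> fin_cases j <;> simp [coe_parab]

lemma parab_neg (v : Fin 2 → R) (s : R) : parab v (-s) = (parab v s)⁻¹ := by
  rw [eq_inv_iff_mul_eq_one, ← parab_add, neg_add_cancel, parab_zero]

lemma parab_natCast_mul (v : Fin 2 → R) (s : R) (k : ℕ) : parab v (k * s) = parab v s ^ k := by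
  induction k with
  | zero => simp [parab_zero]
  | succ k ih => rw [pow_succ, ← ih, ← parab_add]; congr 1; push_cast; ring

lemma mul_parab (g : SL(2, R)) (v : Fin 2 → R) (s : R) :
    g * parab v s = parab ((g : Matrix (Fin 2) (Fin 2) R) *ᵥ v) s * g := by
  have hd := g.2
  rw [det_fin_two] at hd
  ext i j
  fin_cases i <;> fin_cases j <;>
    simp [coe_parab, Matrix.mul_apply, Fin.sum_univ_two]
  · linear_combination (s * g 0 0 * v 0 * v 1 + s * g 0 1 * v 1 ^ 2) * hd
  · linear_combination (-(s * g 0 0 * v 0 ^ 2) - s * g 0 1 * v 0 * v 1) * hd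
  · linear_combination (s * g 1 0 * v 0 * v 1 + s * g 1 1 * v 1 ^ 2) * hd
  · linear_combination (-(s * g 1 0 * v 0 ^ 2) - s * g 1 1 * v 0 * v 1) * hd

lemma parab_conj (g : SL(2, R)) (v : Fin 2 → R) (s : R) :
    g * parab v s * g⁻¹ = parab ((g : Matrix (Fin 2) (Fin 2) R) *ᵥ v) s := by
  rw [mul_parab, mul_inv_cancel_right]

lemma map_parab {S : Type*} [CommRing S] (f : R →+* S) (v : Fin 2 → R) (s : R) :
    SpecialLinearGroup.map f (parab v s) = parab (f ∘ v) (f s) := by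
  ext i j
  fin_cases i <;> fin_cases j <;> simp [coe_parab]

lemma continuous_parab [TopologicalSpace R] [IsTopologicalRing R] (v : Fin 2 → R) :
    Continuous (parab v) := by
  refine Topology.IsInducing.subtypeVal.continuous_iff.2 (continuous_matrix fun i j => ?_)
  change Continuous fun s => !![1 - s * v 0 * v 1, s * v 0 ^ 2; -(s * v 1 ^ 2),
    1 + s * v 0 * v 1] i j
  fin_cases i <;> fin_cases j <;> simp <;> fun_prop

end Parab

/-- Integers coprime to `p` that tend to zero in `ℚ_q` for all primes `q ≠ p`. -/
def awayFrom (p n : ℕ) : ℕ := ordCompl[p] (n.factorial ^ n)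

lemma pow_dvd_awayFrom {p q n : ℕ} (hp : p.Prime) (hq : q.Prime) (hpq : q ≠ p) (hn : q ≤ n) :
    q ^ n ∣ awayFrom p n := by
  have h : q ^ n ∣ n.factorial ^ n := pow_dvd_pow_of_dvd (Nat.dvd_factorial hq.pos hn) n
  rw [← Nat.ordProj_mul_ordCompl_eq_self (n.factorial ^ n) p] at h
  exact (((Nat.coprime_primes hq hp).2 hpq).pow _ _).dvd_of_dvd_mul_left h

lemma isUnit_awayFrom (p n : ℕ) [hp : Fact p.Prime] : IsUnit (awayFrom p n : ℤ_[p]) := by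
  rw [PadicInt.isUnit_iff, PadicInt.norm_natCast_eq_one_iff]
  exact Nat.coprime_ordCompl hp.1 (pow_ne_zero _ n.factorial_ne_zero)

lemma tendsto_natCast_of_norm_le (p : ℕ) [hp : Fact p.Prime] (x : ℚ_[p]) (k : ℕ → ℕ)
    (h : ∀ᶠ n in atTop, ‖(k n : ℚ_[p]) - x‖ ≤ (p : ℝ) ^ (-n : ℤ)) :
    Tendsto (fun n => (k n : ℚ_[p])) atTop (𝓝 x) := by
  rw [tendsto_iff_norm_sub_tendsto_zero]
  refine squeeze_zero' (.of_forall fun _ => norm_nonneg _) h ?_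
  have : ((p : ℝ))⁻¹ < 1 := inv_lt_one_of_one_lt₀ (mod_cast hp.1.one_lt)
  simpa using tendsto_pow_atTop_nhds_zero_of_lt_one (by positivity) this

/-- The closure of `ℕ` in `∏_p ℚ_p` contains each factor `ℤ_p`. -/
lemma exists_tendsto_single (p : Nat.Primes) (z : ℤ_[(p : ℕ)]) :
    ∃ k : ℕ → ℕ, ∀ q : Nat.Primes, Tendsto (fun n => (k n : ℚ_[(q : ℕ)])) atTop
      (𝓝 ((Pi.single p (z : ℚ_[(p : ℕ)]) : ∀ q : Nat.Primes, ℚ_[(q : ℕ)]) q)) := by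
  choose w hw using fun n => (isUnit_awayFrom p n).dvd (a := z)
  refine ⟨fun n => awayFrom p n * (w n).appr n, fun q => ?_⟩
  apply tendsto_natCast_of_norm_le
  obtain rfl | hqp := eq_or_ne q p
  · refine .of_forall fun n => ?_
    have h := (PadicInt.norm_le_pow_iff_mem_span_pow _ n).2 (PadicInt.appr_spec n (w n))
    have h' : ‖(awayFrom q n : ℤ_[(q : ℕ)]) * ((w n) - (w n).appr n)‖ ≤
        ((q : ℕ) : ℝ) ^ (-n : ℤ) := by
      rw [norm_mul]
      exact (mul_le_of_le_one_left (norm_nonneg _) (PadicInt.norm_le_one _)).trans h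
    rw [mul_sub, ← hw, norm_sub_rev, PadicInt.norm_def] at h'
    simpa using h'
  · filter_upwards [eventually_ge_atTop (q : ℕ)] with n hn
    have h : ((q : ℕ) : ℤ) ^ n ∣ (awayFrom p n * (w n).appr n : ℕ) := by
      exact_mod_cast (pow_dvd_awayFrom p.2 q.2 (fun h => hqp (Subtype.ext h)) hn).mul_right _
    simpa [hqp] using (Padic.norm_int_le_pow_iff_dvd _ n).2 h

section LocalParts

variable (N : Subgroup SL(2, ℚ))

/-- The diagonal embedding of `SL₂(ℚ)` into `∏_p SL₂(ℚ_p)`. -/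
noncomputable def diagSL : SL(2, ℚ) →* ∀ p : Nat.Primes, SL(2, ℚ_[(p : ℕ)]) :=
  MonoidHom.pi fun p => SpecialLinearGroup.map (Rat.castHom ℚ_[(p : ℕ)])

/-- The closure of a subgroup of `SL₂(ℚ)` in `∏_p SL₂(ℚ_p)`. -/
noncomputable def prodClosure : Subgroup (∀ p : Nat.Primes, SL(2, ℚ_[(p : ℕ)])) :=
  (N.map diagSL).topologicalClosure

/-- The elements of `SL₂(ℚ_p)` which, placed in the factor at `p`, lie in `prodClosure N`. -/
noncomputable def localPart (p : Nat.Primes) : Subgroup SL(2, ℚ_[(p : ℕ)]) :=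
  (prodClosure N).comap (MonoidHom.mulSingle (fun p : Nat.Primes => SL(2, ℚ_[(p : ℕ)])) p)

variable {N}

lemma mem_prodClosure {m : ∀ p : Nat.Primes, SL(2, ℚ_[(p : ℕ)])}
    (hm : ∀ p, m p ∈ localPart N p) : m ∈ prodClosure N := by
  have hS (S : Finset Nat.Primes) : (fun p => if p ∈ S then m p else 1) ∈ prodClosure N := by
    induction S using Finset.induction_on with
    | empty => exact (prodClosure N).one_mem
    | insert p S hp ih =>
      convert (prodClosure N).mul_mem (hm p) ih using 1
      ext1 q
      obtain rfl | hqp := eq_or_ne q p <;> simp [*]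
  refine (N.map diagSL).isClosed_topologicalClosure.mem_of_tendsto (b := atTop)
    (tendsto_pi_nhds.2 fun p => ?_) (.of_forall hS)
  refine tendsto_const_nhds.congr' ?_
  filter_upwards [eventually_ge_atTop {p}] with S hpS
  rw [if_pos (hpS (Finset.mem_singleton_self p))]

lemma parab_mem_localPart {v : Fin 2 → ℚ} {s : ℚ} (h : parab v s ∈ N) {p : Nat.Primes}
    {r : ℚ_[(p : ℕ)]} (hr : ‖r‖ ≤ ‖(s : ℚ_[(p : ℕ)])‖) :
    parab (fun i => (v i : ℚ_[(p : ℕ)])) r ∈ localPart N p := by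
  obtain ⟨z, rfl⟩ : ∃ z : ℤ_[(p : ℕ)], r = z * s := by
    obtain hs | hs := eq_or_ne (s : ℚ_[(p : ℕ)]) 0
    · exact ⟨0, by simpa [hs] using hr⟩
    · exact ⟨⟨r / s, by rw [norm_div]; exact div_le_one_of_le₀ hr (norm_nonneg _)⟩, by
        simp [hs]⟩
  obtain ⟨k, hk⟩ := exists_tendsto_single p z
  have hmem (n : ℕ) : diagSL (parab v (k n * s)) ∈ prodClosure N :=
    (N.map diagSL).le_topologicalClosure
      ⟨_, by rw [parab_natCast_mul]; exact N.pow_mem h _, rfl⟩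
  rw [localPart, Subgroup.mem_comap]
  refine (N.map diagSL).isClosed_topologicalClosure.mem_of_tendsto (b := atTop)
    (tendsto_pi_nhds.2 fun q => ?_) (.of_forall hmem)
  have hq := ((continuous_parab (fun i => (v i : ℚ_[(q : ℕ)]))).tendsto _).comp
    ((hk q).mul_const (s : ℚ_[(q : ℕ)]))
  convert hq using 2 with n
  · simp only [diagSL, MonoidHom.pi_apply, map_parab, Function.comp_def]
    congr 1
  · obtain rfl | hqp := eq_or_ne q p
    · simp
    · simp [hqp, parab_zero]

/-- The points of `K` obtained by applying elements of `H` to the point `v 0 / v 1`. -/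
def finiteOrbit {K : Type*} [Field K] (H : Subgroup SL(2, K)) (v : Fin 2 → K) : Set K :=
  {x | ∃ g ∈ H, ((g : Matrix (Fin 2) (Fin 2) K) *ᵥ v) 1 ≠ 0 ∧
    x = ((g : Matrix (Fin 2) (Fin 2) K) *ᵥ v) 0 / ((g : Matrix (Fin 2) (Fin 2) K) *ᵥ v) 1}

lemma mem_closure_finiteOrbit {v : Fin 2 → ℚ} {x : ∀ p : Nat.Primes, ℚ_[(p : ℕ)]}
    (hx : ∀ p, x p ∈ finiteOrbit (localPart N p) (fun i => (v i : ℚ_[(p : ℕ)]))) :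
    x ∈ closure ((fun x : ℚ => fun p : Nat.Primes => (x : ℚ_[(p : ℕ)])) '' finiteOrbit N v) := by
  choose m hmN hm hmx using hx
  let w (g : ∀ p : Nat.Primes, SL(2, ℚ_[(p : ℕ)])) (p : Nat.Primes) : Fin 2 → ℚ_[(p : ℕ)] :=
    (g p : Matrix (Fin 2) (Fin 2) ℚ_[(p : ℕ)]) *ᵥ fun i => (v i : ℚ_[(p : ℕ)])
  have hw (p : Nat.Primes) (i : Fin 2) : Continuous fun g => w g p i :=
    (continuous_apply i).comp (Continuous.matrix_mulVec
      (continuous_subtype_val.comp (continuous_apply p)) continuous_const)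
  have hdiag (n : SL(2, ℚ)) (p : Nat.Primes) (i : Fin 2) :
      w (diagSL n) p i = (((n : Matrix (Fin 2) (Fin 2) ℚ) *ᵥ v) i : ℚ) := by
    simp only [w, diagSL, MonoidHom.pi_apply, SpecialLinearGroup.map_apply_coe]
    simp [mulVec, dotProduct, Fin.sum_univ_two]
  let two : Nat.Primes := ⟨2, Nat.prime_two⟩
  have hopen : IsOpen {g | w g two 1 ≠ 0} := isOpen_ne.preimage (hw two 1)
  have hmem : m ∈ closure ({g | w g two 1 ≠ 0} ∩ (N.map diagSL : Set _)) :=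
    hopen.inter_closure ⟨hm two, mem_prodClosure hmN⟩
  have hcont : ContinuousAt (fun g p => w g p 0 / w g p 1) m :=
    continuousAt_pi.2 fun p => (hw p 0).continuousAt.div (hw p 1).continuousAt (hm p)
  have := mem_closure_image hcont hmem
  rw [← (funext hmx : x = fun p => w m p 0 / w m p 1)] at this
  refine closure_mono ?_ this
  rintro _ ⟨_, ⟨hn0, n, hn, rfl⟩, rfl⟩
  refine ⟨_, ⟨n, hn, fun h => hn0 (by rw [hdiag, h, Rat.cast_zero]), rfl⟩, ?_⟩
  ext1 p
  simp only [hdiag, Rat.cast_div]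

end LocalParts

section Orbits

variable {K : Type*} [NormedField K] {H : Subgroup SL(2, K)}

lemma coe_mul_mulVec (g k : SL(2, K)) (v : Fin 2 → K) :
    ((g * k : SL(2, K)) : Matrix (Fin 2) (Fin 2) K) *ᵥ v =
      (g : Matrix (Fin 2) (Fin 2) K) *ᵥ ((k : Matrix (Fin 2) (Fin 2) K) *ᵥ v) :=
  (mulVec_mulVec v _ _).symm

lemma finiteOrbit_trans {v : Fin 2 → K} {x : K} {g : SL(2, K)} (hg : g ∈ H)
    (h : x ∈ finiteOrbit H ((g : Matrix (Fin 2) (Fin 2) K) *ᵥ v)) : x ∈ finiteOrbit H v := by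
  obtain ⟨k, hk, h0, h1⟩ := h
  exact ⟨k * g, H.mul_mem hk hg, by rwa [coe_mul_mulVec], by rwa [coe_mul_mulVec]⟩

lemma parab_one_zero_mulVec (s : K) (v : Fin 2 → K) :
    ((parab ![1, 0] s : SL(2, K)) : Matrix (Fin 2) (Fin 2) K) *ᵥ v = ![v 0 + s * v 1, v 1] := by
  ext i
  fin_cases i <;> simp [coe_parab, mulVec, dotProduct, Fin.sum_univ_two]

lemma parab_zero_one_mulVec (s : K) (v : Fin 2 → K) :
    ((parab ![0, 1] s : SL(2, K)) : Matrix (Fin 2) (Fin 2) K) *ᵥ v = ![v 0, v 1 - s * v 0] := by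
  ext i
  fin_cases i <;> simp [coe_parab, mulVec, dotProduct, Fin.sum_univ_two]
  ring

lemma mem_finiteOrbit_of_sub {v : Fin 2 → K} {x : K} (hv : v 1 ≠ 0)
    (h : parab ![1, 0] (x - v 0 / v 1) ∈ H) : x ∈ finiteOrbit H v := by
  refine ⟨_, h, ?_⟩
  rw [parab_one_zero_mulVec]
  refine ⟨hv, ?_⟩
  simp
  field_simp
  ring

lemma mem_finiteOrbit_of_inv_sub {v : Fin 2 → K} {x : K} (hv : v 0 ≠ 0) (hx : x ≠ 0)
    (h : parab ![0, 1] (v 1 / v 0 - x⁻¹) ∈ H) : x ∈ finiteOrbit H v := by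
  refine ⟨_, h, ?_⟩
  rw [parab_zero_one_mulVec]
  have : v 1 - (v 1 / v 0 - x⁻¹) * v 0 = v 0 / x := by field_simp; ring
  simp only [cons_val_zero, cons_val_one, this]
  exact ⟨div_ne_zero hv hx, by field_simp⟩

lemma parab_smul {R : Type*} [CommRing R] (c : R) (v : Fin 2 → R) (s : R) :
    parab (c • v) s = parab v (c ^ 2 * s) := by
  ext i j
  fin_cases i <;> fin_cases j <;> simp [coe_parab] <;> ring

/-- Two transverse one-parameter unipotent balls that generate an unbounded group generate a
group containing a full one-parameter unipotent group. -/
lemma parab_mem_of_one_lt_norm {α β : K} (hα : ∀ r, ‖r‖ ≤ ‖α‖ → parab ![1, 0] r ∈ H)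
    (hβ : ∀ r, ‖r‖ ≤ ‖β‖ → parab ![0, 1] r ∈ H) (h : 1 < ‖1 - α * β‖) (r : K) :
    parab ![1, 0] r ∈ H := by
  set a := 1 - α * β with ha
  have ha0 : a ≠ 0 := norm_pos_iff.1 (one_pos.trans h)
  have hα0 : α ≠ 0 := by rintro rfl; simp [a] at h
  obtain ⟨D, hDcoe⟩ : ∃ D : SL(2, K), (D : Matrix (Fin 2) (Fin 2) K) = !![a, 0; 0, a⁻¹] :=
    ⟨⟨!![a, 0; 0, a⁻¹], by simp [ha0]⟩, rfl⟩
  have hDdef : D = (parab ![0, 1] (β / a))⁻¹ * (parab ![1, 0] α * parab ![0, 1] β) *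
      (parab ![1, 0] (α / a))⁻¹ := by
    rw [eq_mul_inv_iff_mul_eq, eq_inv_mul_iff_mul_eq]
    ext i j
    fin_cases i <;> fin_cases j <;>
      simp [hDcoe, coe_parab, Matrix.mul_apply, Fin.sum_univ_two] <;> field_simp
    · rw [ha]; ring
    · rw [ha]; ring
  have hdiv (y : K) : ‖y / a‖ ≤ ‖y‖ := by
    rw [norm_div]; exact div_le_self (norm_nonneg _) h.le
  have hD : D ∈ H := hDdef ▸ H.mul_mem (H.mul_mem (H.inv_mem (hβ _ (hdiv _)))
    (H.mul_mem (hα _ le_rfl) (hβ _ le_rfl))) (H.inv_mem (hα _ (hdiv _)))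
  have hDn (n : ℕ) : ((D ^ n : SL(2, K)) : Matrix (Fin 2) (Fin 2) K) *ᵥ ![1, 0] =
      (a ^ n) • ![1, 0] := by
    induction n with
    | zero => simp
    | succ n ih =>
      rw [pow_succ', coe_mul_mulVec, ih, mulVec_smul]
      ext i
      fin_cases i <;> simp [hDcoe, pow_succ]
  obtain ⟨n, hn⟩ := pow_unbounded_of_one_lt (‖r‖ / ‖α‖) h
  have hr : r = (a ^ n) ^ 2 * (r / (a ^ n) ^ 2) := by field_simp
  rw [hr, ← parab_smul, ← hDn, ← parab_conj]
  refine H.mul_mem (H.mul_mem (H.pow_mem hD n) (hα _ ?_)) (H.inv_mem (H.pow_mem hD n))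
  have h1 : 1 ≤ ‖a‖ ^ n := one_le_pow₀ h.le
  rw [div_lt_iff₀ (norm_pos_iff.2 hα0)] at hn
  rw [norm_div, norm_pow, norm_pow, div_le_iff₀ (by positivity)]
  nlinarith [mul_le_mul_of_nonneg_right h1 (mul_nonneg (zero_le_one.trans h1) (norm_nonneg α))]

/-- A variant of `parab_mem_of_one_lt_norm` with an arbitrary finite second fixed point. -/
lemma parab_mem_of_one_lt_norm' {α β x : K} (hα : ∀ r, ‖r‖ ≤ ‖α‖ → parab ![1, 0] r ∈ H)
    (hβ : ∀ r, ‖r‖ ≤ ‖β‖ → parab ![x, 1] r ∈ H) (h : 1 < ‖1 - α * β‖) (r : K) :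
    parab ![1, 0] r ∈ H := by
  have hconj (v : Fin 2 → K) (s : K) :
      parab v s ∈ H.comap (MulAut.conj (parab ![1, 0] x)).toMonoidHom ↔
        parab ![v 0 + x * v 1, v 1] s ∈ H := by
    rw [Subgroup.mem_comap, ← parab_one_zero_mulVec, ← parab_conj]
    rfl
  have := parab_mem_of_one_lt_norm (H := H.comap (MulAut.conj (parab ![1, 0] x)).toMonoidHom)
    (α := α) (β := β) (fun s hs => by rw [hconj]; simpa using hα s hs)
    (fun s hs => by rw [hconj]; simpa using hβ s hs) h r
  rw [hconj] at this
  simpa using this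

end Orbits

section Cusps

/-- The elements of `SL₂(ℚ)` whose class lies in `Δ(6/11, 6)`. -/
def deltaSL : Subgroup SL(2, ℚ) :=
  (Delta (6 / 11) 3).comap (pgl.comp SpecialLinearGroup.toGL)

lemma mem_deltaSL {g : SL(2, ℚ)} :
    g ∈ deltaSL ↔ pgl (SpecialLinearGroup.toGL g) ∈ Delta (6 / 11) 3 := Iff.rfl

lemma pgl_eq_of_smul {A B : GL (Fin 2) ℚ} {c : ℚ} (h : A.val = c • B.val) : pgl A = pgl B := by
  refine (QuotientGroup.eq_iff_div_mem (N := Subgroup.center (GL (Fin 2) ℚ))).2 ?_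
  rw [GeneralLinearGroup.mem_center_iff_val_mem_range_scalar, div_eq_mul_inv]
  refine ⟨c, ?_⟩
  rw [Units.val_mul, h, smul_mul_assoc, ← Units.val_mul, mul_inv_cancel]
  ext i j
  fin_cases i <;> fin_cases j <;> simp

/-- The first generator of `Δ(6/11, 6)`. -/
noncomputable def genOne : GL (Fin 2) ℚ :=
  GeneralLinearGroup.mkOfDetNeZero !![2, 6 / 11; 1, 1] (by norm_num [det_fin_two_of])

/-- The second generator of `Δ(6/11, 6)`. -/
noncomputable def genTwo : GL (Fin 2) ℚ :=
  GeneralLinearGroup.mkOfDetNeZero !![6 / 11, 6 / 11; 1, 27 / 11] (by norm_num [det_fin_two_of])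

lemma coe_genOne : (genOne : Matrix (Fin 2) (Fin 2) ℚ) = !![2, 6 / 11; 1, 1] := rfl

lemma coe_genTwo : (genTwo : Matrix (Fin 2) (Fin 2) ℚ) = !![6 / 11, 6 / 11; 1, 27 / 11] := rfl

lemma coe_genOne_inv : ((genOne⁻¹ : GL (Fin 2) ℚ) : Matrix (Fin 2) (Fin 2) ℚ) =
    !![11 / 16, -(6 / 16); -(11 / 16), 22 / 16] := by
  rw [coe_units_inv, coe_genOne, inv_def, det_fin_two_of, adjugate_fin_two_of]
  norm_num [smul_of]

lemma coe_genTwo_inv : ((genTwo⁻¹ : GL (Fin 2) ℚ) : Matrix (Fin 2) (Fin 2) ℚ) =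
    !![297 / 96, -(66 / 96); -(121 / 96), 66 / 96] := by
  rw [coe_units_inv, coe_genTwo, inv_def, det_fin_two_of, adjugate_fin_two_of]
  norm_num [smul_of]

lemma pgl_genOne_mem : pgl genOne ∈ Delta (6 / 11) 3 :=
  Subgroup.subset_closure ⟨genOne, .inl (by rw [coe_genOne]; norm_num), rfl⟩

lemma pgl_genTwo_mem : pgl genTwo ∈ Delta (6 / 11) 3 :=
  Subgroup.subset_closure ⟨genTwo, .inr (by rw [coe_genTwo]; norm_num), rfl⟩

lemma mem_deltaSL_of_smul {g : SL(2, ℚ)} {A : GL (Fin 2) ℚ} (c : ℚ)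
    (hA : pgl A ∈ Delta (6 / 11) 3) (h : (g : Matrix (Fin 2) (Fin 2) ℚ) = c • A.val) :
    g ∈ deltaSL := by
  rwa [mem_deltaSL, pgl_eq_of_smul (B := A) h]

lemma coe_toGL_parab (v : Fin 2 → ℚ) (s : ℚ) :
    (SpecialLinearGroup.toGL (parab v s) : Matrix (Fin 2) (Fin 2) ℚ) =
      !![1 - s * v 0 * v 1, s * v 0 ^ 2; -(s * v 1 ^ 2), 1 + s * v 0 * v 1] := rfl

lemma parab_infty_mem : parab ![1, 0] 6 ∈ deltaSL := by
  refine mem_deltaSL_of_smul (A := genOne * genTwo⁻¹ * genOne⁻¹ * genTwo) (-1) ?_ ?_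
  · simp only [map_mul, map_inv]
    exact mul_mem (mul_mem (mul_mem pgl_genOne_mem (inv_mem pgl_genTwo_mem))
      (inv_mem pgl_genOne_mem)) pgl_genTwo_mem
  · simp only [Units.val_mul, coe_genOne, coe_genTwo, coe_genOne_inv, coe_genTwo_inv, coe_parab,
      mul_fin_two, smul_of]
    norm_num

lemma parab_zero_mem : parab ![0, 1] 11 ∈ deltaSL := by
  refine mem_deltaSL_of_smul (A := genOne⁻¹ * genTwo * genOne * genTwo⁻¹) (-1) ?_ ?_
  · simp only [map_mul, map_inv]
    exact mul_mem (mul_mem (mul_mem (inv_mem pgl_genOne_mem) pgl_genTwo_mem) pgl_genOne_mem)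
      (inv_mem pgl_genTwo_mem)
  · simp only [Units.val_mul, coe_genOne, coe_genTwo, coe_genOne_inv, coe_genTwo_inv, coe_parab,
      mul_fin_two, smul_of]
    norm_num

lemma parab_two_mem : parab ![2, 1] (33 / 8) ∈ deltaSL := by
  refine mem_deltaSL_of_smul
    (A := genOne * SpecialLinearGroup.toGL (parab ![1, 0] 6) * genOne⁻¹) 1 ?_ ?_
  · simp only [map_mul, map_inv]
    exact mul_mem (mul_mem pgl_genOne_mem parab_infty_mem) (inv_mem pgl_genOne_mem)
  · simp only [Units.val_mul, coe_toGL_parab, coe_genOne, coe_genOne_inv, coe_parab,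
      mul_fin_two, smul_of]
    norm_num

lemma parab_six_elevenths_mem : parab ![6, 11] (1 / 16) ∈ deltaSL := by
  refine mem_deltaSL_of_smul
    (A := genTwo * SpecialLinearGroup.toGL (parab ![1, 0] 6) * genTwo⁻¹) 1 ?_ ?_
  · simp only [map_mul, map_inv]
    exact mul_mem (mul_mem pgl_genTwo_mem parab_infty_mem) (inv_mem pgl_genTwo_mem)
  · simp only [Units.val_mul, coe_toGL_parab, coe_genTwo, coe_genTwo_inv, coe_parab,
      mul_fin_two, smul_of]
    norm_num

lemma parab_one_eleventh_mem : parab ![1, 11] 6 ∈ deltaSL := by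
  have h := mul_mem (mul_mem (inv_mem parab_zero_mem) parab_infty_mem)
    (inv_mem (inv_mem parab_zero_mem))
  rw [← parab_neg, parab_conj, parab_zero_one_mulVec] at h
  simpa using h

lemma div_mem_finiteCusps {v : Fin 2 → ℚ} {s : ℚ} (h : parab v s ∈ deltaSL) (hs : s ≠ 0)
    (hv : v 1 ≠ 0) : v 0 / v 1 ∈ finiteCusps (Delta (6 / 11) 3) := by
  have hc : (SpecialLinearGroup.toGL (parab v s)).val =
    !![1 - s * v 0 * v 1, s * v 0 ^ 2; -(s * v 1 ^ 2), 1 + s * v 0 * v 1] := rfl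
  refine ⟨SpecialLinearGroup.toGL (parab v s), h, fun h1 => ?_, ?_, ?_⟩
  · have h2 := (QuotientGroup.eq_one_iff _).1 h1
    rw [GeneralLinearGroup.mem_center_iff_val_mem_range_scalar] at h2
    obtain ⟨c, hc'⟩ := h2
    have := congrFun (congrFun (hc'.trans hc) 1) 0
    simp [hs, hv] at this
  · rw [hc, trace_fin_two_of, det_fin_two_of]
    ring
  · have hden : -(s * v 1 ^ 2) * (v 0 / v 1) + (1 + s * v 0 * v 1) = 1 := by field_simp; ring
    have hnum : (1 - s * v 0 * v 1) * (v 0 / v 1) + s * v 0 ^ 2 = v 0 / v 1 := by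
      field_simp; ring
    change (if (SpecialLinearGroup.toGL (parab v s)).val 1 0 * (v 0 / v 1) +
      (SpecialLinearGroup.toGL (parab v s)).val 1 1 = 0 then _ else _) = _
    simp only [hc, of_apply, cons_val_zero, cons_val_one, hden, hnum, one_ne_zero, if_false,
      div_one]

lemma finiteOrbit_subset_finiteCusps {v : Fin 2 → ℚ} {s : ℚ} (h : parab v s ∈ deltaSL)
    (hs : s ≠ 0) : finiteOrbit deltaSL v ⊆ finiteCusps (Delta (6 / 11) 3) := by
  rintro _ ⟨g, hg, h1, rfl⟩
  refine div_mem_finiteCusps (s := s) ?_ hs h1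
  rw [← parab_conj]
  exact mul_mem (mul_mem hg h) (inv_mem hg)

end Cusps

section Transitivity

variable {p : Nat.Primes}

lemma parab_infty_mem_localPart {r : ℚ_[(p : ℕ)]} (hr : ‖r‖ ≤ ‖(6 : ℚ_[(p : ℕ)])‖) :
    parab ![1, 0] r ∈ localPart deltaSL p := by
  convert parab_mem_localPart parab_infty_mem (p := p) (r := r) (by simpa using hr) using 2
  ext i
  fin_cases i <;> simp

lemma parab_zero_mem_localPart {r : ℚ_[(p : ℕ)]} (hr : ‖r‖ ≤ ‖(11 : ℚ_[(p : ℕ)])‖) :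
    parab ![0, 1] r ∈ localPart deltaSL p := by
  convert parab_mem_localPart parab_zero_mem (p := p) (r := r) (by simpa using hr) using 2
  ext i
  fin_cases i <;> simp

lemma parab_two_mem_localPart {r : ℚ_[(p : ℕ)]} (hr : ‖r‖ ≤ ‖(33 / 8 : ℚ_[(p : ℕ)])‖) :
    parab ![2, 1] r ∈ localPart deltaSL p := by
  convert parab_mem_localPart parab_two_mem (p := p) (r := r) (by simpa using hr) using 2
  ext i
  fin_cases i <;> simp

lemma norm_natCast_eq_one_of_not_dvd {n : ℕ} (h : ¬ (p : ℕ) ∣ n) : ‖(n : ℚ_[(p : ℕ)])‖ = 1 :=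
  Padic.norm_natCast_eq_one_iff.2 ((Nat.Prime.coprime_iff_not_dvd p.2).2 h)

lemma norm_le_norm_p_of_lt_one {x : ℚ_[(p : ℕ)]} (h : ‖x‖ < 1) :
    ‖x‖ ≤ ‖((p : ℕ) : ℚ_[(p : ℕ)])‖ := by
  rw [Padic.norm_p, ← _root_.zpow_neg_one, Padic.norm_le_pow_iff_norm_lt_pow_add_one]
  simpa using h

lemma natCast_eq_of_eq {n : ℕ} (h : (p : ℕ) = n) :
    ((p : ℕ) : ℚ_[(p : ℕ)]) = (n : ℚ_[(p : ℕ)]) := congrArg Nat.cast h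

lemma padic_norm_sub_le_max (x y : ℚ_[(p : ℕ)]) : ‖x - y‖ ≤ max ‖x‖ ‖y‖ := by
  simpa [sub_eq_add_neg] using IsUltrametricDist.norm_add_le_max x (-y)

lemma padic_norm_sub_le {x y : ℚ_[(p : ℕ)]} {b : ℝ} (hx : ‖x‖ ≤ b) (hy : ‖y‖ ≤ b) :
    ‖x - y‖ ≤ b :=
  (padic_norm_sub_le_max x y).trans (max_le hx hy)

lemma padic_norm_sub_lt {x y : ℚ_[(p : ℕ)]} {b : ℝ} (hx : ‖x‖ < b) (hy : ‖y‖ < b) :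
    ‖x - y‖ < b :=
  (padic_norm_sub_le_max x y).trans_lt (max_lt hx hy)

lemma mem_finiteOrbit_two (hp : (p : ℕ) = 2) {v : Fin 2 → ℚ_[(p : ℕ)]} (hv : v 1 ≠ 0)
    (x : ℚ_[(p : ℕ)]) : x ∈ finiteOrbit (localPart deltaSL p) v := by
  refine mem_finiteOrbit_of_sub hv
    (parab_mem_of_one_lt_norm' (fun _ => parab_infty_mem_localPart)
      (fun _ => parab_two_mem_localPart) ?_ _)
  have h95 : ‖((95 : ℕ) : ℚ_[(p : ℕ)])‖ = 1 :=
    norm_natCast_eq_one_of_not_dvd (by simp [hp])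
  have h2 : ‖((p : ℕ) : ℚ_[(p : ℕ)])‖ < 1 := Padic.norm_p_lt_one
  have h : (1 - 6 * (33 / 8) : ℚ_[(p : ℕ)]) =
      -((95 : ℕ) : ℚ_[(p : ℕ)]) / ((p : ℕ) : ℚ_[(p : ℕ)]) ^ 2 := by
    rw [natCast_eq_of_eq hp]; norm_num
  have hpos : 0 < ‖((p : ℕ) : ℚ_[(p : ℕ)])‖ := norm_pos_iff.2 (mod_cast p.2.ne_zero)
  rw [h, norm_div, norm_neg, h95, norm_pow, one_lt_div (by positivity)]
  exact pow_lt_one₀ hpos.le h2 two_ne_zero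

lemma mem_finiteOrbit_three (hp : (p : ℕ) = 3) {v : Fin 2 → ℚ_[(p : ℕ)]} (hv : v 1 ≠ 0)
    {x : ℚ_[(p : ℕ)]} (h : ‖x‖ < 1 ∧ ‖v 0 / v 1‖ < 1 ∨ 1 ≤ ‖x‖ ∧ 1 ≤ ‖v 0 / v 1‖) :
    x ∈ finiteOrbit (localPart deltaSL p) v := by
  obtain ⟨hx, hy⟩ | ⟨hx, hy⟩ := h
  · refine mem_finiteOrbit_of_sub hv (parab_infty_mem_localPart ?_)
    have h2 : ‖((2 : ℕ) : ℚ_[(p : ℕ)])‖ = 1 :=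
      norm_natCast_eq_one_of_not_dvd (by simp [hp])
    have h6 : (6 : ℚ_[(p : ℕ)]) = ((2 : ℕ) : ℚ_[(p : ℕ)]) * ((p : ℕ) : ℚ_[(p : ℕ)]) := by
      rw [natCast_eq_of_eq hp]; norm_num
    rw [h6, norm_mul, h2, one_mul]
    exact norm_le_norm_p_of_lt_one (padic_norm_sub_lt hx hy)
  · have h11 : ‖((11 : ℕ) : ℚ_[(p : ℕ)])‖ = 1 :=
      norm_natCast_eq_one_of_not_dvd (by simp [hp])
    have hv0 : v 0 ≠ 0 := fun h0 => by norm_num [h0] at hy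
    have hx0 : x ≠ 0 := norm_pos_iff.1 (one_pos.trans_le hx)
    refine mem_finiteOrbit_of_inv_sub hv0 hx0 (parab_zero_mem_localPart ?_)
    rw [Nat.cast_ofNat] at h11
    rw [h11, ← inv_div]
    exact padic_norm_sub_le (by rw [norm_inv]; exact inv_le_one_of_one_le₀ hy)
      (by rw [norm_inv]; exact inv_le_one_of_one_le₀ hx)

lemma mem_finiteOrbit_eleven (hp : (p : ℕ) = 11) {v : Fin 2 → ℚ_[(p : ℕ)]} (hv : v 1 ≠ 0)
    {x : ℚ_[(p : ℕ)]} (h : ‖x‖ ≤ 1 ∧ ‖v 0 / v 1‖ ≤ 1 ∨ 1 < ‖x‖ ∧ 1 < ‖v 0 / v 1‖) :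
    x ∈ finiteOrbit (localPart deltaSL p) v := by
  obtain ⟨hx, hy⟩ | ⟨hx, hy⟩ := h
  · have h6 : ‖((6 : ℕ) : ℚ_[(p : ℕ)])‖ = 1 :=
      norm_natCast_eq_one_of_not_dvd (by simp [hp])
    rw [Nat.cast_ofNat] at h6
    exact mem_finiteOrbit_of_sub hv
      (parab_infty_mem_localPart (h6 ▸ padic_norm_sub_le hx hy))
  · have hv0 : v 0 ≠ 0 := fun h0 => by norm_num [h0] at hy
    have hx0 : x ≠ 0 := norm_pos_iff.1 (one_pos.trans hx)
    refine mem_finiteOrbit_of_inv_sub hv0 hx0 (parab_zero_mem_localPart ?_)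
    have h11 : (11 : ℚ_[(p : ℕ)]) = ((p : ℕ) : ℚ_[(p : ℕ)]) := by
      rw [natCast_eq_of_eq hp]; norm_num
    rw [h11, ← inv_div]
    exact norm_le_norm_p_of_lt_one (padic_norm_sub_lt
      (by rw [norm_inv]; exact inv_lt_one_of_one_lt₀ hy)
      (by rw [norm_inv]; exact inv_lt_one_of_one_lt₀ hx))

lemma mem_finiteOrbit_of_ne (h2 : (p : ℕ) ≠ 2) (h3 : (p : ℕ) ≠ 3) (h11 : (p : ℕ) ≠ 11)
    {v : Fin 2 → ℚ_[(p : ℕ)]} (hv : v 1 ≠ 0) (hy : ‖v 0 / v 1‖ ≤ 1) (x : ℚ_[(p : ℕ)]) :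
    x ∈ finiteOrbit (localPart deltaSL p) v := by
  have n6 : ‖((6 : ℕ) : ℚ_[(p : ℕ)])‖ = 1 := by
    refine norm_natCast_eq_one_of_not_dvd fun h => ?_
    obtain h | h := (Nat.Prime.dvd_mul p.2).1 (show (p : ℕ) ∣ 2 * 3 from h)
    · exact h2 ((Nat.prime_dvd_prime_iff_eq p.2 Nat.prime_two).1 h)
    · exact h3 ((Nat.prime_dvd_prime_iff_eq p.2 Nat.prime_three).1 h)
  have n11 : ‖((11 : ℕ) : ℚ_[(p : ℕ)])‖ = 1 :=
    norm_natCast_eq_one_of_not_dvd fun h =>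
      h11 ((Nat.prime_dvd_prime_iff_eq p.2 (by norm_num)).1 h)
  rw [Nat.cast_ofNat] at n6 n11
  obtain hx | hx := le_or_gt ‖x‖ 1
  · exact mem_finiteOrbit_of_sub hv (parab_infty_mem_localPart (n6 ▸ padic_norm_sub_le hx hy))
  · have hx0 : x ≠ 0 := norm_pos_iff.1 (one_pos.trans hx)
    refine finiteOrbit_trans (g := parab ![1, 0] (1 - v 0 / v 1))
      (parab_infty_mem_localPart (n6 ▸ padic_norm_sub_le norm_one.le hy)) ?_
    have h1 : v 0 + (1 - v 0 / v 1) * v 1 = v 1 := by field_simp; ring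
    rw [parab_one_zero_mulVec, h1]
    refine mem_finiteOrbit_of_inv_sub hv hx0 (parab_zero_mem_localPart ?_)
    rw [n11]
    refine padic_norm_sub_le (by simp [div_self hv]) ?_
    rw [norm_inv]
    exact inv_le_one_of_one_le₀ hx.le

end Transitivity

lemma mem_closure_finiteCusps {a b : ℚ} {s : ℚ} (h : parab ![a, b] s ∈ deltaSL) (hs : s ≠ 0)
    (hb : b ≠ 0) {x : ∀ p : Nat.Primes, ℚ_[(p : ℕ)]}
    (h3 : ∀ p : Nat.Primes, (p : ℕ) = 3 →
      ‖x p‖ < 1 ∧ ‖((a / b : ℚ) : ℚ_[(p : ℕ)])‖ < 1 ∨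
        1 ≤ ‖x p‖ ∧ 1 ≤ ‖((a / b : ℚ) : ℚ_[(p : ℕ)])‖)
    (h11 : ∀ p : Nat.Primes, (p : ℕ) = 11 →
      ‖x p‖ ≤ 1 ∧ ‖((a / b : ℚ) : ℚ_[(p : ℕ)])‖ ≤ 1 ∨
        1 < ‖x p‖ ∧ 1 < ‖((a / b : ℚ) : ℚ_[(p : ℕ)])‖)
    (hp : ∀ p : Nat.Primes, (p : ℕ) ≠ 11 → ‖((a / b : ℚ) : ℚ_[(p : ℕ)])‖ ≤ 1) :
    x ∈ closure ((fun x : ℚ => fun p : Nat.Primes => (x : ℚ_[(p : ℕ)])) ''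
      finiteCusps (Delta (6 / 11) 3)) := by
  refine closure_mono (Set.image_mono (finiteOrbit_subset_finiteCusps h hs))
    (mem_closure_finiteOrbit fun p => ?_)
  have hb' : ((![a, b] 1 : ℚ) : ℚ_[(p : ℕ)]) ≠ 0 := by simpa using hb
  have hdiv : ((a / b : ℚ) : ℚ_[(p : ℕ)]) = (![a, b] 0 : ℚ) / (![a, b] 1 : ℚ) := by simp
  by_cases p2 : (p : ℕ) = 2
  · exact mem_finiteOrbit_two p2 hb' _
  by_cases p3 : (p : ℕ) = 3
  · exact mem_finiteOrbit_three p3 hb' (hdiv ▸ h3 p p3)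
  by_cases p11 : (p : ℕ) = 11
  · exact mem_finiteOrbit_eleven p11 hb' (hdiv ▸ h11 p p11)
  · exact mem_finiteOrbit_of_ne p2 p3 p11 hb' (hdiv ▸ hp p p11) _

lemma norm_natCast_div_eleven_le_one {p : Nat.Primes} (hp : (p : ℕ) ≠ 11) (n : ℕ) :
    ‖(((n : ℚ) / 11 : ℚ) : ℚ_[(p : ℕ)])‖ ≤ 1 := by
  have h11 : ‖((11 : ℕ) : ℚ_[(p : ℕ)])‖ = 1 :=
    norm_natCast_eq_one_of_not_dvd fun h =>
      hp ((Nat.prime_dvd_prime_iff_eq p.2 (by norm_num)).1 h)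
  rw [Nat.cast_ofNat] at h11
  simpa [h11] using Padic.norm_int_le_one (p := (p : ℕ)) n

lemma one_lt_norm_natCast_div_eleven {p : Nat.Primes} (hp : (p : ℕ) = 11) {n : ℕ}
    (hn : ¬ 11 ∣ n) : 1 < ‖(((n : ℚ) / 11 : ℚ) : ℚ_[(p : ℕ)])‖ := by
  have h11 : (11 : ℚ_[(p : ℕ)]) = ((p : ℕ) : ℚ_[(p : ℕ)]) := by
    rw [natCast_eq_of_eq hp]; norm_num
  have hpos : 0 < ‖((p : ℕ) : ℚ_[(p : ℕ)])‖ := norm_pos_iff.2 (mod_cast p.2.ne_zero)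
  rw [Rat.cast_div, Rat.cast_natCast, Rat.cast_ofNat, norm_div,
    norm_natCast_eq_one_of_not_dvd (by rwa [hp]), h11, one_lt_div hpos]
  exact Padic.norm_p_lt_one

/-- For `u² = 6/11` and `t = 3`, the finite cusp set of `Δ(6/11, 6)` is dense
in the product `∏_p ℚ_p` over all primes, with the product topology. -/
theorem cusps_dense_prod_all_padic_six_elevenths :
    Dense ((fun x : ℚ => fun p : Nat.Primes => (x : ℚ_[(p : ℕ)])) ''
      finiteCusps (Delta (6 / 11) 3)) := by
  intro x
  have two_norm {p : Nat.Primes} (hp : (p : ℕ) ≠ 2) : ‖((2 : ℕ) : ℚ_[(p : ℕ)])‖ = 1 :=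
    norm_natCast_eq_one_of_not_dvd fun h =>
      hp ((Nat.prime_dvd_prime_iff_eq p.2 Nat.prime_two).1 h)
  have eleven_norm {p : Nat.Primes} (hp : (p : ℕ) = 3) : ‖((11 : ℕ) : ℚ_[(p : ℕ)])‖ = 1 :=
    norm_natCast_eq_one_of_not_dvd (by simp [hp])
  simp only [Nat.cast_ofNat] at two_norm eleven_norm
  let three : Nat.Primes := ⟨3, Nat.prime_three⟩
  let eleven : Nat.Primes := ⟨11, by norm_num⟩
  have eq_three {p : Nat.Primes} (hp : (p : ℕ) = 3) : p = three := Subtype.ext hp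
  have eq_eleven {p : Nat.Primes} (hp : (p : ℕ) = 11) : p = eleven := Subtype.ext hp
  obtain h3 | h3 := lt_or_ge ‖x three‖ 1 <;> obtain h11 | h11 := le_or_gt ‖x eleven‖ 1
  · refine mem_closure_finiteCusps parab_zero_mem (by norm_num) one_ne_zero
      (fun p hp => .inl ⟨eq_three hp ▸ h3, by simp⟩)
      (fun p hp => .inl ⟨eq_eleven hp ▸ h11, by simp⟩) (fun p hp => by simp)
  · refine mem_closure_finiteCusps parab_six_elevenths_mem (by norm_num) (by norm_num)
      (fun p hp => .inl ⟨eq_three hp ▸ h3, ?_⟩)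
      (fun p hp => .inr ⟨eq_eleven hp ▸ h11, one_lt_norm_natCast_div_eleven hp (by norm_num)⟩)
      (fun p hp => norm_natCast_div_eleven_le_one hp 6)
    have h6 : (6 : ℚ_[(p : ℕ)]) = 2 * ((p : ℕ) : ℚ_[(p : ℕ)]) := by
      rw [natCast_eq_of_eq hp]; norm_num
    rw [Rat.cast_div, Rat.cast_ofNat, Rat.cast_ofNat, norm_div, eleven_norm hp, div_one, h6,
      norm_mul, two_norm (by simp [hp]), one_mul]
    exact Padic.norm_p_lt_one
  · refine mem_closure_finiteCusps parab_two_mem (by norm_num) one_ne_zero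
      (fun p hp => .inr ⟨eq_three hp ▸ h3, ?_⟩)
      (fun p hp => .inl ⟨eq_eleven hp ▸ h11, ?_⟩) (fun p hp => ?_)
    · simp [two_norm (p := p) (by simp [hp])]
    · simp [two_norm (p := p) (by simp [hp])]
    · simpa using Padic.norm_int_le_one (p := (p : ℕ)) 2
  · refine mem_closure_finiteCusps parab_one_eleventh_mem (by norm_num) (by norm_num)
      (fun p hp => .inr ⟨eq_three hp ▸ h3, by simp [eleven_norm hp]⟩)
      (fun p hp => .inr ⟨eq_eleven hp ▸ h11, ?_⟩) (fun p hp => ?_)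
    · simpa using one_lt_norm_natCast_div_eleven hp (n := 1) (by norm_num)
    · simpa using norm_natCast_div_eleven_le_one hp 1
end
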